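/- arXiv:1611.08946 — 2 statements merged into one kernel-verified Lean document; each statement's English description precedes it below -/
import Mathlib

section
/- There exist constants ε₀ ∈ (0, 1/2) and c₀ > 0 such that for every even n > 20 the following holds. Let ν be the distribution on pairs (x,y) ∈ {0,1}^n × {0,1}^n obtained by choosing j uniformly in {1,…,n/2} and then choosing (x,y) uniformly at random subject to x_i = y_i for all i < j. Every one-way quantum protocol with shared entanglement — Alice applies a single controlled isometry to her input register and her half of the entanglement, sends a message register C of c = log₂ dim C qubits to Bob, who then measures a designated output qubit — that outputs GT(x,y) with probability at least 1 − ε₀ on average over (x,y) ← ν satisfies c ≥ c₀ · n. -/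
open scoped BigOperators Classical ComplexOrder

noncomputable section

namespace GTOneWay

/-- The integer value of a bit string, first coordinate most significant. -/
def bitVal (n : ℕ) (x : Fin n → Bool) : ℕ :=
  ∑ i : Fin n, if x i then 2 ^ (n - 1 - (i : ℕ)) else 0

/-- The Greater-Than function. -/
def GT (n : ℕ) (q : (Fin n → Bool) × (Fin n → Bool)) : Bool :=
  decide (bitVal n q.2 ≤ bitVal n q.1)

/-- For `j` ranging over `{0, …, n/2 − 1}` (representing the index `j+1 ∈ {1, …, n/2}`),
the condition that `x` and `y` agree on all coordinates `i < j`. -/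
def agreeBelow (n : ℕ) (q : (Fin n → Bool) × (Fin n → Bool)) (j : Fin (n / 2)) : Prop :=
  ∀ i : Fin n, (i : ℕ) < (j : ℕ) → q.1 i = q.2 i

/-- The hard distribution `ν` for Greater-Than: pick `j` uniformly in `{1, …, n/2}` and
then `(x, y)` uniformly subject to `x_i = y_i` for all `i < j`. -/
def gtNu (n : ℕ) (q : (Fin n → Bool) × (Fin n → Bool)) : ℝ :=
  ((n / 2 : ℕ) : ℝ)⁻¹ * ∑ j : Fin (n / 2),
    if agreeBelow n q j then
      (((Finset.univ.filter (fun q' : (Fin n → Bool) × (Fin n → Bool) =>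
        agreeBelow n q' j)).card : ℝ))⁻¹
    else 0

/-- The success probability of a one-way protocol with shared entanglement `θ`,
Alice's controlled isometry `U`, Bob's controlled isometry `V` and output
measurement `out`, on input distribution `ν`, for target function `F`. -/
def owSuccess {n dTA dTB dA dC dB : ℕ}
    (θ : Fin dTA × Fin dTB → ℂ)
    (U : (Fin n → Bool) → ((Fin dTA → ℂ) →ₗ[ℂ] (Fin dA × Fin dC → ℂ)))
    (V : (Fin n → Bool) → ((Fin dC × Fin dTB → ℂ) →ₗ[ℂ] (Fin dB → ℂ)))
    (out : Fin dB → Bool)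
    (ν : (Fin n → Bool) × (Fin n → Bool) → ℝ)
    (F : (Fin n → Bool) × (Fin n → Bool) → Bool) : ℝ :=
  ∑ x : Fin n → Bool, ∑ y : Fin n → Bool, ν (x, y) *
    ∑ a : Fin dA, ∑ b : Fin dB,
      if out b = F (x, y) then
        Complex.normSq (V y (fun ct => U x (fun ta => θ (ta, ct.2)) (a, ct.1)) b)
      else 0

open Matrix

/-- The Schatten norm of order `2 ^ (k + 1)`. -/
def schatten : ℕ → ∀ {m n : Type} [Fintype m] [Fintype n], Matrix m n ℂ → ℝ
  | 0, _, _, _, _, X => √(∑ i, ∑ j, ‖X i j‖ ^ 2)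
  | k + 1, _, _, _, _, X => √(schatten k (Xᴴ * X))

section Schatten

variable {m n : Type} [Fintype m] [Fintype n]

lemma trace_conjTranspose_mul_self_re (X : Matrix m n ℂ) :
    (trace (Xᴴ * X)).re = ∑ i, ∑ j, ‖X i j‖ ^ 2 := by
  simp only [trace, diag_apply, mul_apply, conjTranspose_apply, Complex.re_sum]
  rw [Finset.sum_comm]
  refine Finset.sum_congr rfl fun i _ => Finset.sum_congr rfl fun j _ => ?_
  rw [← Complex.normSq_eq_norm_sq, Complex.normSq_apply]
  simp

lemma schatten_nonneg (k : ℕ) (X : Matrix m n ℂ) : 0 ≤ schatten k X := by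
  cases k <;> exact Real.sqrt_nonneg _

lemma schatten_succ_sq (k : ℕ) (X : Matrix m n ℂ) :
    schatten (k + 1) X ^ 2 = schatten k (Xᴴ * X) :=
  Real.sq_sqrt (schatten_nonneg _ _)

lemma norm_trace_mul_sq_le (X : Matrix m n ℂ) (Y : Matrix n m ℂ) :
    ‖trace (X * Y)‖ ^ 2 ≤ (trace (Xᴴ * X)).re * (trace (Yᴴ * Y)).re := by
  rw [trace_conjTranspose_mul_self_re, trace_conjTranspose_mul_self_re]
  have h1 : ‖trace (X * Y)‖ ≤ ∑ p : m × n, ‖X p.1 p.2‖ * ‖Y p.2 p.1‖ := by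
    rw [Fintype.sum_prod_type]
    simp only [trace, diag_apply, mul_apply]
    refine (norm_sum_le _ _).trans (Finset.sum_le_sum fun i _ => ?_)
    refine (norm_sum_le _ _).trans (Finset.sum_le_sum fun j _ => ?_)
    rw [norm_mul]
  refine (pow_le_pow_left₀ (norm_nonneg _) h1 2).trans
    ((Finset.sum_mul_sq_le_sq_mul_sq _ _ _).trans (le_of_eq ?_))
  simp only [Fintype.sum_prod_type]
  congr 1
  exact Finset.sum_comm

variable [DecidableEq m] [DecidableEq n]

lemma schatten_pow (k : ℕ) (X : Matrix m n ℂ) :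
    schatten k X ^ 2 ^ (k + 1) = (trace ((Xᴴ * X) ^ 2 ^ k)).re := by
  induction k generalizing m with
  | zero =>
    simp only [schatten, zero_add, pow_one, pow_zero]
    rw [Real.sq_sqrt (by positivity), trace_conjTranspose_mul_self_re]
  | succ k ih =>
    rw [pow_succ' 2 (k + 1), pow_mul, schatten_succ_sq, ih]
    simp only [conjTranspose_mul, conjTranspose_conjTranspose]
    rw [← sq, ← pow_mul, ← pow_succ']

lemma trace_mul_pow_comm (X : Matrix m n ℂ) (Y : Matrix n m ℂ) (r : ℕ) (hr : r ≠ 0) :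
    trace ((X * Y) ^ r) = trace ((Y * X) ^ r) := by
  obtain ⟨r, rfl⟩ := Nat.exists_eq_succ_of_ne_zero hr
  have key : ∀ r : ℕ, (X * Y) ^ r * X = X * (Y * X) ^ r := by
    intro r
    induction r with
    | zero => simp
    | succ r ih => rw [pow_succ', Matrix.mul_assoc, ih, pow_succ']; simp only [Matrix.mul_assoc]
  rw [Nat.succ_eq_add_one, pow_succ, ← Matrix.mul_assoc, key, trace_mul_comm, ← Matrix.mul_assoc,
    ← pow_succ']

lemma norm_trace_pow_aux (j : ℕ) :
    (∀ X : Matrix n n ℂ, ‖trace (X ^ 2 ^ (j + 1))‖ ≤ (trace ((Xᴴ * X) ^ 2 ^ j)).re) ∧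
    (∀ P Q : Matrix n n ℂ, P.IsHermitian → Q.IsHermitian →
      ‖trace ((P * Q) ^ 2 ^ j)‖ ^ 2 ≤
        (trace (P ^ 2 ^ (j + 1))).re * (trace (Q ^ 2 ^ (j + 1))).re) := by
  induction j with
  | zero =>
    refine ⟨fun X => ?_, fun P Q hP hQ => ?_⟩
    · have h := norm_trace_mul_sq_le X X
      rw [← sq] at h
      simp only [zero_add, pow_one, pow_zero]
      rw [sq X]
      refine le_of_sq_le_sq ?_ ?_
      · simpa [sq] using h
      · rw [trace_conjTranspose_mul_self_re]; positivity
    · have h := norm_trace_mul_sq_le P Q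
      rw [hP.eq, hQ.eq] at h
      simpa [sq] using h
  | succ j ih =>
    obtain ⟨hL, hH⟩ := ih
    refine ⟨fun X => ?_, fun P Q hP hQ => ?_⟩
    · have hnn : 0 ≤ (trace ((Xᴴ * X) ^ 2 ^ (j + 1))).re := by
        rw [← schatten_pow]; exact pow_nonneg (schatten_nonneg _ _) _
      have h1 := hL (X ^ 2)
      rw [← pow_mul, ← pow_succ'] at h1
      have h2 : trace (((X ^ 2)ᴴ * X ^ 2) ^ 2 ^ j) = trace (((X * Xᴴ) * (Xᴴ * X)) ^ 2 ^ j) := by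
        have : (X ^ 2)ᴴ * X ^ 2 = Xᴴ * (Xᴴ * X * X) := by
          rw [sq, conjTranspose_mul]; simp only [Matrix.mul_assoc]
        rw [this, trace_mul_pow_comm _ _ _ (by positivity)]
        have : Xᴴ * X * X * Xᴴ = (Xᴴ * X) * (X * Xᴴ) := by simp only [Matrix.mul_assoc]
        rw [this, trace_mul_pow_comm _ _ _ (by positivity)]
      rw [h2] at h1
      have h3 := hH (X * Xᴴ) (Xᴴ * X) (isHermitian_mul_conjTranspose_self X)
        (isHermitian_conjTranspose_mul_self X)
      rw [trace_mul_pow_comm X Xᴴ _ (by positivity), ← sq] at h3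
      have h4 := (Complex.re_le_norm _).trans (le_of_sq_le_sq h3 hnn)
      exact h1.trans h4
    · have h1 := hL (P * Q)
      have h2 : trace (((P * Q)ᴴ * (P * Q)) ^ 2 ^ j) = trace ((P ^ 2 * Q ^ 2) ^ 2 ^ j) := by
        have : (P * Q)ᴴ * (P * Q) = Q * (P * P * Q) := by
          rw [conjTranspose_mul, hP.eq, hQ.eq]; simp only [Matrix.mul_assoc]
        rw [this, trace_mul_pow_comm _ _ _ (by positivity), sq, sq]
        simp only [Matrix.mul_assoc]
      rw [h2] at h1
      have h3 := hH (P ^ 2) (Q ^ 2) (hP.pow 2) (hQ.pow 2)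
      rw [← pow_mul, ← pow_mul, ← pow_succ'] at h3
      refine (pow_le_pow_left₀ (norm_nonneg _) (h1.trans (Complex.re_le_norm _)) 2).trans h3

lemma schatten_conjTranspose_mul_le (k : ℕ) (A B : Matrix m n ℂ) :
    schatten k (Aᴴ * B) ≤ schatten (k + 1) A * schatten (k + 1) B := by
  have hnn : 0 ≤ schatten (k + 1) A * schatten (k + 1) B :=
    mul_nonneg (schatten_nonneg _ _) (schatten_nonneg _ _)
  refine le_of_pow_le_pow_left₀ (n := 2 ^ (k + 2)) (by positivity) hnn ?_
  rw [mul_pow, schatten_pow, schatten_pow, pow_succ 2 (k + 1), pow_mul, schatten_pow]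
  have h1 : trace (((Aᴴ * B)ᴴ * (Aᴴ * B)) ^ 2 ^ k) = trace (((A * Aᴴ) * (B * Bᴴ)) ^ 2 ^ k) := by
    have : (Aᴴ * B)ᴴ * (Aᴴ * B) = Bᴴ * (A * Aᴴ * B) := by
      rw [conjTranspose_mul, conjTranspose_conjTranspose]; simp only [Matrix.mul_assoc]
    rw [this, trace_mul_pow_comm _ _ _ (by positivity)]
    simp only [Matrix.mul_assoc]
  have h2 := (norm_trace_pow_aux k).2 (A * Aᴴ) (B * Bᴴ) (isHermitian_mul_conjTranspose_self A)
    (isHermitian_mul_conjTranspose_self B)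
  rw [trace_mul_pow_comm A Aᴴ _ (by positivity), trace_mul_pow_comm B Bᴴ _ (by positivity),
    ← h1] at h2
  refine le_trans ?_ h2
  rw [← sq_abs]
  exact pow_le_pow_left₀ (abs_nonneg _) (Complex.abs_re_le_norm _) 2

lemma schatten_add_le (k : ℕ) (A B : Matrix m n ℂ) :
    schatten k (A + B) ≤ schatten k A + schatten k B := by
  induction k generalizing m with
  | zero =>
    let _ : NormedAddCommGroup (Matrix m n ℂ) := Matrix.frobeniusNormedAddCommGroup
    have h : ∀ X : Matrix m n ℂ, schatten 0 X = ‖X‖ := by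
      intro X
      rw [Matrix.frobenius_norm_def]
      simp [schatten, Real.sqrt_eq_rpow]
    rw [h, h, h]
    exact norm_add_le _ _
  | succ k ih =>
    have hA := schatten_nonneg (k + 1) A
    have hB := schatten_nonneg (k + 1) B
    refine le_of_sq_le_sq ?_ (add_nonneg hA hB)
    rw [schatten_succ_sq]
    have h : (A + B)ᴴ * (A + B) = (Aᴴ * A + Aᴴ * B) + (Bᴴ * A + Bᴴ * B) := by
      rw [conjTranspose_add, Matrix.add_mul, Matrix.mul_add, Matrix.mul_add]
    rw [h]
    have h1 := ih (Aᴴ * A + Aᴴ * B) (Bᴴ * A + Bᴴ * B)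
    have h2 := ih (Aᴴ * A) (Aᴴ * B)
    have h3 := ih (Bᴴ * A) (Bᴴ * B)
    have h4 := schatten_conjTranspose_mul_le k A B
    have h5 := schatten_conjTranspose_mul_le k B A
    rw [← schatten_succ_sq] at h2 h3
    nlinarith

/-- The 2-uniform smoothness inequality for the Schatten norms of order `2 ^ (k + 1)`. -/
lemma schatten_two_point (k : ℕ) (A B : Matrix m n ℂ) :
    schatten k (A + B) ^ 2 ^ (k + 1) + schatten k (A - B) ^ 2 ^ (k + 1) ≤
      2 * (schatten k A ^ 2 + (2 ^ (k + 1) - 1) * schatten k B ^ 2) ^ 2 ^ k := by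
  induction k generalizing m with
  | zero =>
    simp only [schatten, zero_add, pow_one, pow_zero]
    rw [Real.sq_sqrt (by positivity), Real.sq_sqrt (by positivity), Real.sq_sqrt (by positivity),
      Real.sq_sqrt (by positivity)]
    refine le_of_eq ?_
    norm_num
    simp only [← Finset.sum_add_distrib, Finset.mul_sum]
    refine Finset.sum_congr rfl fun i _ => Finset.sum_congr rfl fun j _ => ?_
    have := parallelogram_law_with_norm ℝ (A i j) (B i j)
    nlinarith
  | succ k ih =>
    have hA := schatten_nonneg (k + 1) A
    have hB := schatten_nonneg (k + 1) B
    set a := schatten (k + 1) A with ha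
    set b := schatten (k + 1) B with hb
    set S := Aᴴ * A + Bᴴ * B with hS
    set T := Aᴴ * B + Bᴴ * A with hT
    have h1 : (A + B)ᴴ * (A + B) = S + T := by
      rw [conjTranspose_add, Matrix.add_mul, Matrix.mul_add, Matrix.mul_add, hS, hT]; abel
    have h2 : (A - B)ᴴ * (A - B) = S - T := by
      rw [conjTranspose_sub, Matrix.sub_mul, Matrix.mul_sub, Matrix.mul_sub, hS, hT]; abel
    rw [pow_succ' 2 (k + 1), pow_mul, pow_mul, schatten_succ_sq, schatten_succ_sq, h1, h2]
    refine (ih S T).trans ?_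
    have hs : schatten k S ≤ a ^ 2 + b ^ 2 := by
      rw [ha, hb, schatten_succ_sq, schatten_succ_sq]; exact schatten_add_le _ _ _
    have ht : schatten k T ≤ 2 * a * b := by
      have h4 := schatten_conjTranspose_mul_le k A B
      have h5 := schatten_conjTranspose_mul_le k B A
      have := schatten_add_le k (Aᴴ * B) (Bᴴ * A)
      rw [← ha, ← hb] at h4 h5
      linarith
    have hs2 := pow_le_pow_left₀ (schatten_nonneg k S) hs 2
    have ht2 := pow_le_pow_left₀ (schatten_nonneg k T) ht 2
    have hK : (1 : ℝ) ≤ 2 ^ (k + 1) := one_le_pow₀ (by norm_num)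
    rw [pow_succ' (2 : ℕ) k, pow_mul _ 2 (2 ^ k)]
    refine mul_le_mul_of_nonneg_left (pow_le_pow_left₀ ?_ ?_ _) (by norm_num)
    · have := mul_nonneg (sub_nonneg.2 hK) (sq_nonneg (schatten k T))
      positivity
    · rw [pow_succ' (2 : ℝ) (k + 1)]
      set K : ℝ := 2 ^ (k + 1)
      have h6 := mul_le_mul_of_nonneg_left ht2 (sub_nonneg.2 hK)
      have h7 : 0 ≤ ((2 * K - 1) ^ 2 - 1) * b ^ 4 := by
        apply mul_nonneg _ (by positivity)
        nlinarith
      nlinarith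

end Schatten

/-- A discrete Minkowski inequality for adding a constant. -/
lemma sum_add_const_pow_le {ι : Type*} [Fintype ι] (X : ι → ℝ) (hX : ∀ i, 0 ≤ X i) (M c : ℝ)
    (hM : 0 ≤ M) (hc : 0 ≤ c) (r : ℕ) (hr : r ≠ 0)
    (h : ∑ i, X i ^ r ≤ Fintype.card ι * M ^ r) :
    ∑ i, (X i + c) ^ r ≤ Fintype.card ι * (M + c) ^ r := by
  rcases hM.eq_or_lt with rfl | hM
  · rw [zero_pow hr, mul_zero] at h
    have h0 : ∀ i, X i = 0 := fun i => by
      have := (Finset.sum_eq_zero_iff_of_nonneg fun i _ => pow_nonneg (hX i) r).1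
        (le_antisymm h (Finset.sum_nonneg fun i _ => pow_nonneg (hX i) r)) i (Finset.mem_univ i)
      exact pow_eq_zero_iff hr |>.1 this
    simp [h0]
  · have hMc : 0 < M + c := by linarith
    have key : ∀ i, (X i + c) ^ r ≤
        (M + c) ^ r * (M / (M + c) * (X i ^ r / M ^ r) + c / (M + c)) := by
      intro i
      have h1 : X i / M ∈ Set.Ici (0 : ℝ) := div_nonneg (hX i) hM.le
      have h2 : (1 : ℝ) ∈ Set.Ici (0 : ℝ) := Set.mem_Ici.2 zero_le_one
      have h3 : 0 ≤ M / (M + c) := by positivity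
      have h4 : 0 ≤ c / (M + c) := by positivity
      have := (convexOn_pow (𝕜 := ℝ) r).2 h1 h2 h3 h4 (by field_simp)
      simp only [smul_eq_mul, one_pow, mul_one, div_pow] at this
      have e : M / (M + c) * (X i / M) + c / (M + c) = (X i + c) / (M + c) := by field_simp
      rw [e, div_pow, div_le_iff₀ (by positivity)] at this
      linarith
    refine (Finset.sum_le_sum fun i _ => key i).trans ?_
    rw [← Finset.mul_sum, Finset.sum_add_distrib, ← Finset.mul_sum, ← Finset.sum_div,
      Finset.sum_const, Finset.card_univ, nsmul_eq_mul, mul_comm]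
    refine mul_le_mul_of_nonneg_right ?_ (by positivity)
    have h1 : (∑ i, X i ^ r) / M ^ r ≤ Fintype.card ι := by
      rwa [div_le_iff₀ (by positivity)]
    calc _ ≤ M / (M + c) * Fintype.card ι + Fintype.card ι * (c / (M + c)) := by gcongr
      _ = Fintype.card ι := by field_simp

/-- The sign of a bit. -/
def bitSign (b : Bool) : ℝ := if b then 1 else -1

lemma bitSign_not (b : Bool) : bitSign (!b) = -bitSign b := by cases b <;> simp [bitSign]

/-- Flip one coordinate of a bit string. -/
def flipBit {n : ℕ} (j : Fin n) (x : Fin n → Bool) : Fin n → Bool :=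
  Function.update x j (!x j)

lemma flipBit_involutive {n : ℕ} (j : Fin n) : Function.Involutive (flipBit j) := by
  intro x; simp [flipBit]

lemma flipBit_self {n : ℕ} (j : Fin n) (x : Fin n → Bool) : flipBit j x j = !x j := by
  simp [flipBit]

lemma flipBit_of_ne {n : ℕ} {i j : Fin n} (h : i ≠ j) (x : Fin n → Bool) :
    flipBit j x i = x i := by
  simp [flipBit, h]

lemma sum_flipBit {n : ℕ} (j : Fin n) (f : (Fin n → Bool) → ℝ) :
    ∑ x, f (flipBit j x) = ∑ x, f x :=
  Equiv.sum_comp (flipBit_involutive j).toPerm f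

/-- Moment bound for a matrix martingale on the hypercube whose increments are signed by the
current bit. -/
lemma sum_schatten_martingale_le {n : ℕ} {d : Type} [Fintype d] [DecidableEq d] (k : ℕ)
    (B : Fin n → (Fin n → Bool) → Matrix d d ℂ)
    (hB : ∀ j x x', (∀ i < j, x i = x' i) → B j x = B j x') (b : ℝ)
    (hb : ∀ j x, schatten k (B j x) ≤ b) (J : ℕ) (hJ : J ≤ n) :
    ∑ x, schatten k (∑ j with j.val < J, (bitSign (x j) : ℂ) • B j x) ^ 2 ^ (k + 1) ≤
      Fintype.card (Fin n → Bool) * (J * ((2 ^ (k + 1) - 1) * b ^ 2)) ^ 2 ^ k := by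
  have hK : (1 : ℝ) ≤ 2 ^ (k + 1) := one_le_pow₀ (by norm_num)
  have hK' : (0 : ℝ) ≤ 2 ^ (k + 1) - 1 := by linarith
  induction J with
  | zero =>
    have h0 : schatten k (0 : Matrix d d ℂ) = 0 := by
      have := schatten_pow k (0 : Matrix d d ℂ)
      rw [conjTranspose_zero, Matrix.zero_mul, zero_pow (by positivity), trace_zero,
        Complex.zero_re] at this
      exact pow_eq_zero_iff (by positivity) |>.1 this
    simp [h0]
  | succ J ih =>
    specialize ih (by omega)
    set jj : Fin n := ⟨J, hJ⟩ with hjj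
    set Z : (Fin n → Bool) → Matrix d d ℂ :=
      fun x => ∑ j with j.val < J, (bitSign (x j) : ℂ) • B j x with hZ
    have hfil : (Finset.univ.filter fun j : Fin n => j.val < J + 1) =
        insert jj (Finset.univ.filter fun j : Fin n => j.val < J) := by
      ext j
      simp only [Finset.mem_filter, Finset.mem_univ, true_and, Finset.mem_insert, hjj, Fin.ext_iff]
      omega
    have hsum : ∀ x, ∑ j with j.val < J + 1, (bitSign (x j) : ℂ) • B j x =
        Z x + (bitSign (x jj) : ℂ) • B jj x := by
      intro x
      rw [hfil, Finset.sum_insert (by simp [hjj]), add_comm]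
    have hflip : ∀ (j : Fin n) (x : Fin n → Bool), j.val ≤ J → B j (flipBit jj x) = B j x := by
      intro j x hj
      refine hB _ _ _ fun i hi => flipBit_of_ne ?_ _
      rintro rfl
      simp only [hjj, Fin.lt_def] at hi
      omega
    have hZflip : ∀ x, Z (flipBit jj x) = Z x := by
      intro x
      refine Finset.sum_congr rfl fun j hj => ?_
      simp only [Finset.mem_filter, Finset.mem_univ, true_and] at hj
      rw [hflip j x hj.le, flipBit_of_ne]
      rintro rfl
      simp [hjj] at hj
    have hpair : ∀ x, schatten k (Z x + (bitSign (x jj) : ℂ) • B jj x) ^ 2 ^ (k + 1) +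
        schatten k (Z (flipBit jj x) + (bitSign (flipBit jj x jj) : ℂ) • B jj (flipBit jj x)) ^
          2 ^ (k + 1) ≤
        2 * (schatten k (Z x) ^ 2 + (2 ^ (k + 1) - 1) * b ^ 2) ^ 2 ^ k := by
      intro x
      rw [hZflip, hflip jj x le_rfl, flipBit_self, bitSign_not]
      have h1 := schatten_two_point k (Z x) (B jj x)
      have h2 : 2 * (schatten k (Z x) ^ 2 + (2 ^ (k + 1) - 1) * schatten k (B jj x) ^ 2) ^ 2 ^ k ≤
          2 * (schatten k (Z x) ^ 2 + (2 ^ (k + 1) - 1) * b ^ 2) ^ 2 ^ k := by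
        have := pow_le_pow_left₀ (schatten_nonneg k (B jj x)) (hb jj x) 2
        have h3 := schatten_nonneg k (B jj x)
        gcongr
      refine le_trans ?_ (h1.trans h2)
      cases x jj
      · simp [bitSign, sub_eq_add_neg, add_comm]
      · simp [bitSign, sub_eq_add_neg]
    have h2 := Finset.sum_le_sum fun x (_ : x ∈ Finset.univ) => hpair x
    rw [Finset.sum_add_distrib, sum_flipBit jj fun x =>
      schatten k (Z x + (bitSign (x jj) : ℂ) • B jj x) ^ 2 ^ (k + 1), ← Finset.mul_sum] at h2
    simp only [hsum]
    have h3 := sum_add_const_pow_le (fun x => schatten k (Z x) ^ 2) (fun x => sq_nonneg _)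
      (J * ((2 ^ (k + 1) - 1) * b ^ 2)) ((2 ^ (k + 1) - 1) * b ^ 2) (by positivity) (by positivity)
      (2 ^ k) (by positivity) (by simpa only [← pow_mul, ← pow_succ'] using ih)
    refine le_trans (by linarith) (h3.trans (le_of_eq ?_))
    push_cast
    ring

lemma norm_diag_sq_le {d : Type} [Fintype d] [DecidableEq d] {Z : Matrix d d ℂ}
    (hZ : Z.IsHermitian) (i : d) : ‖Z i i‖ ^ 2 ≤ ((Z ^ 2) i i).re := by
  have h : ((Z ^ 2) i i).re = ∑ j, ‖Z i j‖ ^ 2 := by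
    rw [sq, mul_apply, Complex.re_sum]
    refine Finset.sum_congr rfl fun j _ => ?_
    rw [← hZ.apply j i, ← Complex.normSq_eq_norm_sq, Complex.normSq_apply]
    simp
  rw [h]
  exact Finset.single_le_sum (f := fun j => ‖Z i j‖ ^ 2) (fun j _ => by positivity)
    (Finset.mem_univ i)

lemma norm_diag_pow_le {d : Type} [Fintype d] [DecidableEq d] (k : ℕ) {Z : Matrix d d ℂ}
    (hZ : Z.IsHermitian) (i : d) : ‖Z i i‖ ^ 2 ^ (k + 1) ≤ ((Z ^ 2 ^ (k + 1)) i i).re := by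
  induction k generalizing Z with
  | zero => simpa using norm_diag_sq_le hZ i
  | succ k ih =>
    have h2 := ih (hZ.pow 2)
    rw [← pow_mul, ← pow_succ'] at h2
    refine le_trans ?_ h2
    rw [pow_succ' 2 (k + 1), pow_mul]
    exact pow_le_pow_left₀ (by positivity)
      ((norm_diag_sq_le hZ i).trans (Complex.re_le_norm _)) _

lemma quadForm_conj_diagonal {d : Type} [Fintype d] [DecidableEq d] (U : Matrix d d ℂ)
    (w : d → ℝ) (f : d → ℂ) :
    (star f ⬝ᵥ (U * diagonal (fun i => (w i : ℂ)) * Uᴴ) *ᵥ f).re =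
      ∑ i, w i * ‖(Uᴴ *ᵥ f) i‖ ^ 2 := by
  rw [← mulVec_mulVec, ← mulVec_mulVec, dotProduct_mulVec]
  have : star f ᵥ* U = star (Uᴴ *ᵥ f) := by rw [star_mulVec, conjTranspose_conjTranspose]
  rw [this]
  simp only [dotProduct, mulVec_diagonal, Pi.star_apply, Complex.re_sum]
  refine Finset.sum_congr rfl fun i _ => ?_
  rw [← Complex.normSq_eq_norm_sq, Complex.normSq_apply]
  simp
  ring

lemma mul_pow_le_of_le_inv_mean {d : Type} [Fintype d] (q μ : d → ℝ) (hq : ∀ l, 0 ≤ q l)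
    (hq1 : ∑ l, q l = 1) (hμ : ∀ l, 0 < μ l) (r : ℕ) :
    1 ≤ (∑ l, q l * (μ l ^ r)⁻¹) * (∑ l, q l * μ l) ^ r := by
  have ht : 0 < ∑ l, q l * μ l := by
    obtain ⟨l, hl⟩ : ∃ l, 0 < q l := by
      by_contra! h
      have : ∑ l, q l ≤ 0 := Finset.sum_nonpos fun l _ => h l
      linarith
    exact Finset.sum_pos' (fun l _ => mul_nonneg (hq l) (hμ l).le)
      ⟨l, Finset.mem_univ _, mul_pos hl (hμ l)⟩
  have h := (convexOn_zpow (𝕜 := ℝ) (-(r : ℤ))).map_sum_le (t := Finset.univ) (w := q) (p := μ)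
    (fun i _ => hq i) hq1 (fun i _ => hμ i)
  simp only [smul_eq_mul, _root_.zpow_neg, zpow_natCast] at h
  rw [inv_le_iff_one_le_mul₀ (by positivity)] at h
  exact h

/-- Change of measure: if the state `ρ` is dominated by `D` times the diagonal operator with
entries `lam ^ (2 p)`, then expectations under `ρ` are controlled by weighted Schatten `p`-norms. -/
lemma re_trace_mul_pow_le {d : Type} [Fintype d] [DecidableEq d] (k : ℕ) (lam : d → ℝ)
    (hlam : ∀ i, 0 < lam i) {ρ : Matrix d d ℂ} (hρ : ρ.PosSemidef) (htr : trace ρ = 1) (D : ℝ)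
    (hle : ∀ v : d → ℂ, (star v ⬝ᵥ ρ *ᵥ v).re ≤
      D * ∑ i, lam i ^ (2 * 2 ^ (k + 1)) * ‖v i‖ ^ 2)
    {Y : Matrix d d ℂ} (hY : Y.IsHermitian) :
    (trace (ρ * Y)).re ^ 2 ^ (k + 1) ≤ D * schatten k
      (diagonal (fun i => (lam i : ℂ)) * Y * diagonal (fun i => (lam i : ℂ))) ^ 2 ^ (k + 1) := by
  set Λ : Matrix d d ℂ := diagonal (fun i => (lam i : ℂ)) with hΛ
  set Λi : Matrix d d ℂ := diagonal (fun i => ((lam i)⁻¹ : ℂ)) with hΛi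
  have hΛΛi : Λ * Λi = 1 := by
    rw [hΛ, hΛi, diagonal_mul_diagonal, ← diagonal_one]
    congr 1
    ext i
    exact mul_inv_cancel₀ (by exact_mod_cast (hlam i).ne')
  have hΛH : Λᴴ = Λ := by
    rw [hΛ, diagonal_conjTranspose]; congr 1; ext i; simp
  have hΛiH : Λiᴴ = Λi := by
    rw [hΛi, diagonal_conjTranspose]; congr 1; ext i; simp
  have hΛiΛ : Λi * Λ = 1 := mul_eq_one_comm.1 hΛΛi
  set W := Λi * ρ * Λi with hWdef
  have hW : W.PosSemidef := by
    have := hρ.conjTranspose_mul_mul_same Λi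
    rwa [hΛiH] at this
  obtain ⟨U, w, hw, hU, hWU⟩ : ∃ (U : Matrix d d ℂ) (w : d → ℝ), (∀ i, 0 ≤ w i) ∧ Uᴴ * U = 1 ∧
      W = U * diagonal (fun i => (w i : ℂ)) * Uᴴ := by
    refine ⟨hW.1.eigenvectorUnitary, hW.1.eigenvalues, hW.eigenvalues_nonneg, ?_, ?_⟩
    · exact Unitary.coe_star_mul_self _
    · exact hW.1.spectral_theorem
  have hU' : U * Uᴴ = 1 := mul_eq_one_comm.1 hU
  have htrace : ∀ X : Matrix d d ℂ,
      (trace (ρ * X)).re = ∑ i, w i * ((Uᴴ * (Λ * X * Λ) * U) i i).re := by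
    intro X
    have h1 : ρ = Λ * W * Λ := by
      rw [hWdef]
      calc ρ = (Λ * Λi) * ρ * (Λi * Λ) := by rw [hΛΛi, hΛiΛ]; simp
        _ = _ := by simp only [Matrix.mul_assoc]
    have h2 : trace (ρ * X) =
        trace (diagonal (fun i => (w i : ℂ)) * (Uᴴ * (Λ * X * Λ) * U)) := by
      rw [h1, hWU]
      calc _ = trace (Λ * (U * diagonal (fun i => (w i : ℂ)) * Uᴴ * Λ * X)) := by
            simp only [Matrix.mul_assoc]
        _ = trace (U * (diagonal (fun i => (w i : ℂ)) * Uᴴ * Λ * X * Λ)) := by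
            rw [trace_mul_comm]; simp only [Matrix.mul_assoc]
        _ = _ := by rw [trace_mul_comm]; simp only [Matrix.mul_assoc]
    rw [h2]
    simp [trace, diagonal_mul]
  set t : d → ℝ := fun i => ∑ l, ‖U l i‖ ^ 2 * lam l ^ 2 with ht
  set S : d → ℝ := fun i => ∑ l, ‖U l i‖ ^ 2 * ((lam l ^ 2) ^ (2 ^ (k + 1) - 1))⁻¹ with hS
  have hcol : ∀ i, ∑ l, ‖U l i‖ ^ 2 = 1 := by
    intro i
    have h := congrArg Complex.re (congrFun (congrFun hU i) i)
    simp only [mul_apply, conjTranspose_apply, one_apply_eq, Complex.one_re, Complex.re_sum] at h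
    rw [← h]
    refine Finset.sum_congr rfl fun l _ => ?_
    rw [← Complex.normSq_eq_norm_sq, Complex.normSq_apply]
    simp
  have hdiag : ∀ (g : d → ℝ) i, (Uᴴ *ᵥ fun l => (g l : ℂ) * U l i) i =
      ((∑ l, ‖U l i‖ ^ 2 * g l : ℝ) : ℂ) := by
    intro g i
    simp only [mulVec, dotProduct, conjTranspose_apply]
    push_cast
    refine Finset.sum_congr rfl fun l _ => ?_
    rw [← Complex.conj_mul']
    simp only [Complex.star_def]
    ring
  have htsum : ∑ i, w i * t i = 1 := by
    have h := htrace 1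
    rw [Matrix.mul_one, htr, Complex.one_re] at h
    rw [h]
    refine Finset.sum_congr rfl fun i _ => ?_
    congr 1
    have h2 : (Uᴴ * (Λ * (1 : Matrix d d ℂ) * Λ) * U) i i =
        (Uᴴ *ᵥ fun l => ((lam l ^ 2 : ℝ) : ℂ) * U l i) i := by
      rw [Matrix.mul_one, hΛ, diagonal_mul_diagonal, Matrix.mul_assoc, mul_apply]
      simp only [mulVec, dotProduct, diagonal_mul]
      push_cast
      simp only [sq]
    rw [h2, hdiag, Complex.ofReal_re]
  have hp : 2 ^ (k + 1) = (2 ^ (k + 1) - 1) + 1 := (Nat.sub_add_cancel Nat.one_le_two_pow).symm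
  have hjen : ∀ i, 1 ≤ S i * t i ^ (2 ^ (k + 1) - 1) := fun i =>
    mul_pow_le_of_le_inv_mean (fun l => ‖U l i‖ ^ 2) (fun l => lam l ^ 2)
      (fun l => by positivity) (hcol i) (fun l => pow_pos (hlam l) 2) _
  have hS0 : ∀ i, 0 ≤ S i := fun i => Finset.sum_nonneg fun l _ => by
    have := hlam l; positivity
  have ht0 : ∀ i, 0 ≤ t i := fun i => Finset.sum_nonneg fun l _ => by positivity
  have hSpos : ∀ i, 0 < S i := fun i => by
    rcases (hS0 i).eq_or_lt with h | h
    · have := hjen i; rw [← h] at this; norm_num at this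
    · exact h
  have hrpos : 2 ^ (k + 1) - 1 ≠ 0 := by
    have : 2 ≤ 2 ^ (k + 1) := by rw [pow_succ]; have := Nat.one_le_two_pow (n := k); omega
    omega
  have htpos : ∀ i, 0 < t i := fun i => by
    rcases (ht0 i).eq_or_lt with h | h
    · have := hjen i; rw [← h, zero_pow hrpos] at this; norm_num at this
    · exact h
  have hwS : ∀ i, w i * S i ≤ D := by
    intro i
    set g : d → ℝ := fun l => ((lam l ^ 2) ^ (2 ^ (k + 1) - 1))⁻¹ with hg
    set f : d → ℂ := fun l => (g l : ℂ) * U l i with hf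
    have h1 := hle (Λi *ᵥ f)
    have h2 : star (Λi *ᵥ f) ⬝ᵥ ρ *ᵥ (Λi *ᵥ f) = star f ⬝ᵥ W *ᵥ f := by
      rw [star_mulVec, hΛiH, ← dotProduct_mulVec, mulVec_mulVec, mulVec_mulVec, hWdef]
    rw [h2, hWU, quadForm_conj_diagonal] at h1
    have h3 : w i * S i ^ 2 ≤ ∑ j, w j * ‖(Uᴴ *ᵥ f) j‖ ^ 2 := by
      refine le_trans (le_of_eq ?_) (Finset.single_le_sum
        (f := fun j => w j * ‖(Uᴴ *ᵥ f) j‖ ^ 2)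
        (fun j _ => mul_nonneg (hw j) (sq_nonneg _)) (Finset.mem_univ i))
      simp only [hf]
      rw [hdiag, Complex.norm_real, Real.norm_eq_abs, sq_abs]
    have h4 : ∑ l, lam l ^ (2 * 2 ^ (k + 1)) * ‖(Λi *ᵥ f) l‖ ^ 2 = S i := by
      refine Finset.sum_congr rfl fun l _ => ?_
      have hl := (hlam l).ne'
      rw [hΛi, mulVec_diagonal]
      simp only [hf, hg]
      rw [norm_mul, norm_mul, ← Complex.ofReal_inv, Complex.norm_real, Complex.norm_real,
        Real.norm_eq_abs, Real.norm_eq_abs, mul_pow, mul_pow, sq_abs, sq_abs, pow_mul]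
      nth_rw 1 [hp]
      rw [pow_succ]
      field_simp
    rw [h4] at h1
    have h5 := h3.trans h1
    rw [sq, ← mul_assoc] at h5
    exact le_of_mul_le_mul_right h5 (hSpos i)
  set Z := Λ * Y * Λ with hZdef
  have hZ : Z.IsHermitian := by
    have := isHermitian_conjTranspose_mul_mul Λ hY
    rwa [hΛH] at this
  set Z' := Uᴴ * Z * U with hZ'def
  have hZ' : Z'.IsHermitian := isHermitian_conjTranspose_mul_mul U hZ
  have hsch : schatten k Z ^ 2 ^ (k + 1) = ∑ i, ((Z' ^ 2 ^ (k + 1)) i i).re := by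
    have h1 : trace (Z' ^ 2 ^ (k + 1)) = trace (Z ^ 2 ^ (k + 1)) := by
      rw [hZ'def, Matrix.mul_assoc, trace_mul_pow_comm _ _ _ (by positivity), Matrix.mul_assoc, hU',
        Matrix.mul_one]
    rw [schatten_pow, hZ.eq, ← sq, ← pow_mul, ← pow_succ', ← h1]
    simp [trace]
  rw [hsch, htrace Y]
  have heven : Even (2 ^ (k + 1)) := by rw [pow_succ]; exact even_two.mul_left _
  have hJ := Real.pow_arith_mean_le_arith_mean_pow_of_even Finset.univ (fun i => w i * t i)
    (fun i => (Z' i i).re / t i) (fun i _ => mul_nonneg (hw i) (ht0 i)) htsum heven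
  have h1 : ∑ i, w i * t i * ((Z' i i).re / t i) = ∑ i, w i * (Z' i i).re :=
    Finset.sum_congr rfl fun i _ => by have := (htpos i).ne'; field_simp
  rw [h1] at hJ
  refine hJ.trans ?_
  rw [Finset.mul_sum]
  refine Finset.sum_le_sum fun i _ => ?_
  have h2 : (Z' i i).re ^ 2 ^ (k + 1) ≤ ((Z' ^ 2 ^ (k + 1)) i i).re := by
    refine le_trans ?_ (norm_diag_pow_le k hZ' i)
    rw [← heven.pow_abs]
    exact pow_le_pow_left₀ (abs_nonneg _) (Complex.abs_re_le_norm _) _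
  have h3 : w i ≤ D * t i ^ (2 ^ (k + 1) - 1) := by
    calc w i ≤ w i * (S i * t i ^ (2 ^ (k + 1) - 1)) := le_mul_of_one_le_right (hw i) (hjen i)
      _ = w i * S i * t i ^ (2 ^ (k + 1) - 1) := by ring
      _ ≤ _ := mul_le_mul_of_nonneg_right (hwS i) (pow_nonneg (ht0 i) _)
  have hD : 0 ≤ D := (mul_nonneg (hw i) (hS0 i)).trans (hwS i)
  refine le_trans ?_ (mul_le_mul_of_nonneg_left h2 hD)
  rw [div_pow, ← mul_div_assoc, div_le_iff₀ (pow_pos (htpos i) _)]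
  have h4 : 0 ≤ t i * (Z' i i).re ^ 2 ^ (k + 1) := mul_nonneg (ht0 i) (heven.pow_nonneg _)
  have h5 := mul_le_mul_of_nonneg_right h3 h4
  have h6 : t i ^ 2 ^ (k + 1) = t i ^ (2 ^ (k + 1) - 1) * t i := by
    rw [← pow_succ, ← hp]
  rw [h6]
  calc _ = w i * (t i * (Z' i i).re ^ 2 ^ (k + 1)) := by ring
    _ ≤ _ := h5
    _ = _ := by ring

lemma conjTranspose_diagonal_ofReal {d : Type} [Fintype d] [DecidableEq d] (s : d → ℝ) :
    (diagonal fun i => (s i : ℂ))ᴴ = diagonal fun i => (s i : ℂ) := by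
  rw [diagonal_conjTranspose]; congr 1; ext i; simp

/-- The expectation bound for sequential decoding when the dominating state is diagonal. -/
lemma decoding_pow_le_of_diagonal {n : ℕ} {d e : Type} [Fintype d] [DecidableEq d] [Fintype e]
    [DecidableEq e] (V : Fin n → (Fin n → Bool) → Matrix e d ℂ)
    (hVpre : ∀ j x x', (∀ i < j, x i = x' i) → V j x = V j x')
    (hV : ∀ j x, (V j x)ᴴ * V j x = 1) (s : e → ℝ) (hs : ∀ b, s b ^ 2 = 1)
    (ρ : (Fin n → Bool) → Matrix d d ℂ) (hρ : ∀ x, (ρ x).PosSemidef) (htr : ∀ x, trace (ρ x) = 1)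
    (μ : d → ℝ) (hμ : ∀ i, 0 < μ i) (hμ2 : ∑ i, μ i ≤ 2) (D : ℝ) (hD : 0 ≤ D)
    (hle : ∀ x v, (star v ⬝ᵥ ρ x *ᵥ v).re ≤ D * ∑ i, μ i * ‖v i‖ ^ 2)
    (N : ℕ) (hN : N ≤ n) (k : ℕ) (c : ℝ) (hc : 0 ≤ c)
    (hexp : Fintype.card (Fin n → Bool) * c ≤ ∑ x, ∑ j : Fin n with j.val < N, bitSign (x j) *
      (trace (ρ x * ((V j x)ᴴ * diagonal (fun b => (s b : ℂ)) * V j x))).re) :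
    c ^ 2 ^ (k + 1) ≤ 2 * D * (N * (2 ^ (k + 1) - 1)) ^ 2 ^ k := by
  have hK : (1 : ℝ) ≤ 2 ^ (k + 1) := one_le_pow₀ (by norm_num)
  have hK' : (0 : ℝ) ≤ 2 ^ (k + 1) - 1 := by linarith
  set lam : d → ℝ := fun i => μ i ^ (((2 * 2 ^ (k + 1) : ℕ) : ℝ)⁻¹) with hlamdef
  have hlam : ∀ i, 0 < lam i := fun i => Real.rpow_pos_of_pos (hμ i) _
  have hlampow : ∀ i, lam i ^ (2 * 2 ^ (k + 1)) = μ i := fun i =>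
    Real.rpow_inv_natCast_pow (hμ i).le (by positivity)
  set Λ : Matrix d d ℂ := diagonal fun i => (lam i : ℂ) with hΛ
  have hΛH : Λᴴ = Λ := conjTranspose_diagonal_ofReal lam
  set Sg : Matrix e e ℂ := diagonal fun b => (s b : ℂ) with hSg
  have hSgH : Sgᴴ = Sg := conjTranspose_diagonal_ofReal s
  have hSg2 : Sg * Sg = 1 := by
    rw [hSg, diagonal_mul_diagonal, ← diagonal_one]
    congr 1
    ext b
    have := hs b
    rw [← Complex.ofReal_mul, ← sq, this, Complex.ofReal_one]
  set O : Fin n → (Fin n → Bool) → Matrix d d ℂ := fun j x => (V j x)ᴴ * Sg * V j x with hO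
  have hOH : ∀ j x, (O j x).IsHermitian := fun j x =>
    isHermitian_conjTranspose_mul_mul (V j x) hSgH
  set Y : (Fin n → Bool) → Matrix d d ℂ :=
    fun x => ∑ j : Fin n with j.val < N, (bitSign (x j) : ℂ) • O j x with hYdef
  have hY : ∀ x, (Y x).IsHermitian := by
    intro x
    simp only [hYdef, IsHermitian, conjTranspose_sum, conjTranspose_smul]
    refine Finset.sum_congr rfl fun j _ => ?_
    rw [(hOH j x).eq]
    simp
  set b := schatten k (Λ * Λ) with hb
  have hb2 : b ^ 2 ^ (k + 1) ≤ 2 := by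
    rw [hb, schatten_pow, conjTranspose_mul, hΛH, ← sq Λ, ← sq (Λ ^ 2), ← pow_mul, ← pow_mul,
      ← pow_succ' 2 k, hΛ, diagonal_pow, trace_diagonal, Complex.re_sum]
    refine le_trans (le_of_eq (Finset.sum_congr rfl fun i _ => ?_)) hμ2
    rw [← hlampow i, Pi.pow_apply, ← Complex.ofReal_pow, Complex.ofReal_re]
  have hB : ∀ j x, schatten k (Λ * O j x * Λ) ≤ b := by
    intro j x
    have h1 := schatten_conjTranspose_mul_le k (V j x * Λ) (Sg * (V j x * Λ))
    have h2 : (V j x * Λ)ᴴ * (Sg * (V j x * Λ)) = Λ * O j x * Λ := by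
      rw [conjTranspose_mul, hΛH, hO]; simp only [Matrix.mul_assoc]
    have h3 : (V j x * Λ)ᴴ * (V j x * Λ) = Λ * Λ := by
      rw [conjTranspose_mul, hΛH]
      calc _ = Λ * ((V j x)ᴴ * V j x) * Λ := by simp only [Matrix.mul_assoc]
        _ = _ := by rw [hV, Matrix.mul_one]
    have h4 : (Sg * (V j x * Λ))ᴴ * (Sg * (V j x * Λ)) = Λ * Λ := by
      rw [conjTranspose_mul, hSgH, ← h3]
      calc _ = (V j x * Λ)ᴴ * (Sg * Sg) * (V j x * Λ) := by simp only [Matrix.mul_assoc]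
        _ = _ := by rw [hSg2, Matrix.mul_one]
    rw [h2] at h1
    simp only [schatten, h3, h4] at h1
    rwa [Real.mul_self_sqrt (schatten_nonneg _ _)] at h1
  have hmart := sum_schatten_martingale_le k (fun j x => Λ * O j x * Λ)
    (fun j x x' h => by simp only [hO, hVpre j x x' h]) b hB N hN
  have hpt : ∀ x, (trace (ρ x * Y x)).re ^ 2 ^ (k + 1) ≤ D * schatten k
      (∑ j : Fin n with j.val < N, (bitSign (x j) : ℂ) • (Λ * O j x * Λ)) ^ 2 ^ (k + 1) := by
    intro x
    have h := re_trace_mul_pow_le k lam hlam (hρ x) (htr x) D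
      (fun v => by simpa only [hlampow] using hle x v) (hY x)
    have h2 : Λ * Y x * Λ =
        ∑ j : Fin n with j.val < N, (bitSign (x j) : ℂ) • (Λ * O j x * Λ) := by
      rw [hYdef, Finset.mul_sum, Finset.sum_mul]
      simp
    rwa [← h2]
  have hexp' : Fintype.card (Fin n → Bool) * c ≤ ∑ x, (trace (ρ x * Y x)).re := by
    refine hexp.trans (le_of_eq (Finset.sum_congr rfl fun x _ => ?_))
    rw [hYdef, Finset.mul_sum, trace_sum, Complex.re_sum]
    refine Finset.sum_congr rfl fun j _ => ?_
    rw [Matrix.mul_smul, trace_smul, smul_eq_mul, Complex.re_ofReal_mul]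
  have hcard : (0 : ℝ) < Fintype.card (Fin n → Bool) := by exact_mod_cast Fintype.card_pos
  set M : ℝ := (Fintype.card (Fin n → Bool) : ℝ) with hM
  have heven : Even (2 ^ (k + 1)) := by rw [pow_succ]; exact even_two.mul_left _
  have hJ := Real.pow_arith_mean_le_arith_mean_pow_of_even Finset.univ
    (fun _ : Fin n → Bool => M⁻¹) (fun x => (trace (ρ x * Y x)).re) (fun _ _ => by positivity)
    (by rw [Finset.sum_const, Finset.card_univ, nsmul_eq_mul, ← hM, mul_inv_cancel₀ hcard.ne'])
    heven
  rw [← Finset.mul_sum, ← Finset.mul_sum] at hJ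
  have h1 : c ≤ M⁻¹ * ∑ x, (trace (ρ x * Y x)).re := by
    rw [inv_mul_eq_div, le_div_iff₀ hcard]; linarith
  have h2 := (pow_le_pow_left₀ hc h1 (2 ^ (k + 1))).trans hJ
  have h3 := Finset.sum_le_sum fun x (_ : x ∈ Finset.univ) => hpt x
  rw [← Finset.mul_sum] at h3
  have h4 : (N * ((2 ^ (k + 1) - 1) * b ^ 2)) ^ 2 ^ k =
      (N * (2 ^ (k + 1) - 1)) ^ 2 ^ k * b ^ 2 ^ (k + 1) := by
    have h5 : b ^ 2 ^ (k + 1) = (b ^ 2) ^ 2 ^ k := by rw [← pow_mul, ← pow_succ']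
    rw [h5, ← mul_pow]; ring
  rw [h4] at hmart
  calc c ^ 2 ^ (k + 1) ≤ _ := h2
    _ ≤ M⁻¹ * (D * (M * ((N * (2 ^ (k + 1) - 1)) ^ 2 ^ k * 2))) := by
        refine mul_le_mul_of_nonneg_left (h3.trans (mul_le_mul_of_nonneg_left
          (hmart.trans ?_) hD)) (by positivity)
        gcongr
    _ = _ := by field_simp

/-- If the states `ρ x` are all dominated by `D • σ`, then the average total correlation between
the bits of `x` and the outcomes of measurements that may depend on the preceding bits is bounded
in terms of `D`. -/
lemma decoding_pow_le {n : ℕ} {d e : Type} [Fintype d] [DecidableEq d] [Fintype e]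
    [DecidableEq e] (V : Fin n → (Fin n → Bool) → Matrix e d ℂ)
    (hVpre : ∀ j x x', (∀ i < j, x i = x' i) → V j x = V j x')
    (hV : ∀ j x, (V j x)ᴴ * V j x = 1) (s : e → ℝ) (hs : ∀ b, s b ^ 2 = 1)
    (ρ : (Fin n → Bool) → Matrix d d ℂ) (hρ : ∀ x, (ρ x).PosSemidef) (htr : ∀ x, trace (ρ x) = 1)
    (σ : Matrix d d ℂ) (hσ : σ.PosDef) (hσ2 : (trace σ).re ≤ 2) (D : ℝ) (hD : 0 ≤ D)
    (hle : ∀ x v, (star v ⬝ᵥ ρ x *ᵥ v).re ≤ D * (star v ⬝ᵥ σ *ᵥ v).re)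
    (N : ℕ) (hN : N ≤ n) (k : ℕ) (c : ℝ) (hc : 0 ≤ c)
    (hexp : Fintype.card (Fin n → Bool) * c ≤ ∑ x, ∑ j : Fin n with j.val < N, bitSign (x j) *
      (trace (ρ x * ((V j x)ᴴ * diagonal (fun b => (s b : ℂ)) * V j x))).re) :
    c ^ 2 ^ (k + 1) ≤ 2 * D * (N * (2 ^ (k + 1) - 1)) ^ 2 ^ k := by
  obtain ⟨Q, μ, hμ, hQ, hσQ⟩ : ∃ (Q : Matrix d d ℂ) (μ : d → ℝ), (∀ i, 0 < μ i) ∧ Qᴴ * Q = 1 ∧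
      σ = Q * diagonal (fun i => (μ i : ℂ)) * Qᴴ := by
    refine ⟨hσ.1.eigenvectorUnitary, hσ.1.eigenvalues, hσ.eigenvalues_pos, ?_, ?_⟩
    · exact Unitary.coe_star_mul_self _
    · exact hσ.1.spectral_theorem
  have hQ' : Q * Qᴴ = 1 := mul_eq_one_comm.1 hQ
  refine decoding_pow_le_of_diagonal (fun j x => V j x * Q)
    (fun j x x' h => by rw [hVpre j x x' h]) (fun j x => ?_) s hs (fun x => Qᴴ * ρ x * Q)
    (fun x => (hρ x).conjTranspose_mul_mul_same Q) (fun x => ?_) μ hμ ?_ D hD (fun x v => ?_)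
    N hN k c hc ?_
  · rw [conjTranspose_mul]
    calc _ = Qᴴ * ((V j x)ᴴ * V j x) * Q := by simp only [Matrix.mul_assoc]
      _ = 1 := by rw [hV, Matrix.mul_one, hQ]
  · rw [trace_mul_comm, ← Matrix.mul_assoc, hQ', Matrix.one_mul, htr]
  · refine le_trans (le_of_eq ?_) hσ2
    rw [hσQ, trace_mul_comm, ← Matrix.mul_assoc, hQ, Matrix.one_mul, trace_diagonal,
      Complex.re_sum]
    simp
  · have h := hle x (Q *ᵥ v)
    rw [hσQ, quadForm_conj_diagonal, mulVec_mulVec v Qᴴ Q, hQ, one_mulVec] at h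
    have h2 : star (Q *ᵥ v) ⬝ᵥ ρ x *ᵥ Q *ᵥ v = star v ⬝ᵥ (Qᴴ * ρ x * Q) *ᵥ v := by
      rw [star_mulVec, ← dotProduct_mulVec, mulVec_mulVec, mulVec_mulVec, Matrix.mul_assoc]
    rwa [h2] at h
  · refine hexp.trans (le_of_eq (Finset.sum_congr rfl fun x _ =>
      Finset.sum_congr rfl fun j _ => ?_))
    congr 2
    rw [conjTranspose_mul]
    symm
    calc _ = trace (Qᴴ * (ρ x * (Q * Qᴴ) * ((V j x)ᴴ * diagonal (fun b => (s b : ℂ)) * V j x)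
              * Q)) := by simp only [Matrix.mul_assoc]
      _ = trace (ρ x * ((V j x)ᴴ * diagonal (fun b => (s b : ℂ)) * V j x) * (Q * Qᴴ)) := by
          rw [trace_mul_comm]; simp only [hQ', Matrix.mul_one, Matrix.mul_assoc]
      _ = _ := by rw [hQ', Matrix.mul_one]

lemma conjTranspose_mul_self_eq_one_of_normSq {d e : Type} [Fintype d] [DecidableEq d] [Fintype e]
    (A : Matrix e d ℂ)
    (hA : ∀ v, ∑ b, Complex.normSq ((A *ᵥ v) b) = ∑ p, Complex.normSq (v p)) : Aᴴ * A = 1 := by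
  have key : ∀ {m : Type} [Fintype m] (v : m → ℂ),
      star v ⬝ᵥ v = ((∑ p, Complex.normSq (v p) : ℝ) : ℂ) := by
    intro m _ v
    simp [dotProduct, Complex.normSq_eq_conj_mul_self]
  have h0 : ∀ v : d → ℂ, star v ⬝ᵥ (Aᴴ * A - 1) *ᵥ v = 0 := by
    intro v
    rw [sub_mulVec, one_mulVec, dotProduct_sub, ← mulVec_mulVec, dotProduct_mulVec,
      ← star_mulVec, key, key, hA, sub_self]
  have hP : (Aᴴ * A - 1).PosSemidef := by
    refine PosSemidef.of_dotProduct_mulVec_nonneg ?_ fun v => (h0 v).ge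
    exact (isHermitian_conjTranspose_mul_self A).sub isHermitian_one
  rw [← sub_eq_zero]
  ext i j
  have := (hP.dotProduct_mulVec_zero_iff (Pi.single j 1)).1 (h0 _)
  have h2 := congrFun this i
  rwa [mulVec_single_one] at h2

lemma trace_sum_vecMulVec {ι d : Type} [Fintype ι] [Fintype d] (v : ι → d → ℂ) :
    trace (∑ a, vecMulVec (v a) (star (v a))) =
      ((∑ a, ∑ p, Complex.normSq (v a p) : ℝ) : ℂ) := by
  simp [trace_sum, trace_vecMulVec, dotProduct, Complex.mul_conj]

lemma quadForm_sum_vecMulVec {ι d : Type} [Fintype ι] [Fintype d] (v : ι → d → ℂ) (w : d → ℂ) :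
    star w ⬝ᵥ (∑ a, vecMulVec (v a) (star (v a))) *ᵥ w =
      ((∑ a, Complex.normSq (star w ⬝ᵥ v a) : ℝ) : ℂ) := by
  rw [sum_mulVec, dotProduct_sum, Complex.ofReal_sum]
  refine Finset.sum_congr rfl fun a _ => ?_
  have h : star (v a) ⬝ᵥ w = star (star w ⬝ᵥ v a) := by
    rw [star_dotProduct]
  rw [vecMulVec_mulVec, dotProduct_smul, h, ← Complex.mul_conj]
  simp

lemma posSemidef_sum_vecMulVec {ι d : Type} [Fintype ι] [Fintype d] (v : ι → d → ℂ) :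
    (∑ a, vecMulVec (v a) (star (v a))).PosSemidef :=
  posSemidef_sum _ fun a _ => posSemidef_vecMulVec_self_star (v a)

lemma trace_sum_vecMulVec_mul {ι d e : Type} [Fintype ι] [Fintype d] [Fintype e] [DecidableEq e]
    (v : ι → d → ℂ) (A : Matrix e d ℂ) (s : e → ℝ) :
    (trace ((∑ a, vecMulVec (v a) (star (v a))) *
      (Aᴴ * diagonal (fun b => (s b : ℂ)) * A))).re =
      ∑ a, ∑ b, s b * Complex.normSq ((A *ᵥ v a) b) := by
  rw [Finset.sum_mul, trace_sum, Complex.re_sum]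
  refine Finset.sum_congr rfl fun a _ => ?_
  rw [vecMulVec_mul, trace_vecMulVec, dotProduct_comm, ← dotProduct_mulVec]
  have h : star (v a) ⬝ᵥ (Aᴴ * diagonal (fun b => (s b : ℂ)) * A) *ᵥ v a =
      star (A *ᵥ v a) ⬝ᵥ diagonal (fun b => (s b : ℂ)) *ᵥ (A *ᵥ v a) := by
    rw [star_mulVec, ← dotProduct_mulVec, mulVec_mulVec, mulVec_mulVec, Matrix.mul_assoc]
  rw [h, dotProduct, Complex.re_sum]
  refine Finset.sum_congr rfl fun b _ => ?_
  rw [mulVec_diagonal, Pi.star_apply, mul_left_comm, Complex.star_def,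
    ← Complex.normSq_eq_conj_mul_self, ← Complex.ofReal_mul, Complex.ofReal_re]

/-- The bias of the output of a one-way protocol on the input pair `(x, y)`. -/
def owBias {n dTA dTB dA dC dB : ℕ}
    (θ : Fin dTA × Fin dTB → ℂ)
    (U : (Fin n → Bool) → ((Fin dTA → ℂ) →ₗ[ℂ] (Fin dA × Fin dC → ℂ)))
    (V : (Fin n → Bool) → ((Fin dC × Fin dTB → ℂ) →ₗ[ℂ] (Fin dB → ℂ)))
    (out : Fin dB → Bool) (x y : Fin n → Bool) : ℝ :=
  ∑ a : Fin dA, ∑ b : Fin dB, bitSign (out b) *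
    Complex.normSq (V y (fun ct => U x (fun ta => θ (ta, ct.2)) (a, ct.1)) b)

lemma sum_normSq_message {n dTA dTB dA dC : ℕ} (θ : Fin dTA × Fin dTB → ℂ)
    (hθ : ∑ p, Complex.normSq (θ p) = 1)
    (U : (Fin n → Bool) → ((Fin dTA → ℂ) →ₗ[ℂ] (Fin dA × Fin dC → ℂ)))
    (hU : ∀ x v, ∑ p, Complex.normSq (U x v p) = ∑ t, Complex.normSq (v t)) (x : Fin n → Bool) :
    ∑ a, ∑ ct : Fin dC × Fin dTB,
      Complex.normSq (U x (fun ta => θ (ta, ct.2)) (a, ct.1)) = 1 := by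
  simp only [Fintype.sum_prod_type]
  rw [← hθ, Fintype.sum_prod_type_right]
  simp only [← hU x, Fintype.sum_prod_type]
  rw [Finset.sum_comm (γ := Fin dTB)]
  exact Finset.sum_congr rfl fun a _ => Finset.sum_comm

lemma protocol_pow_le {n dTA dTB dA dC dB : ℕ} (θ : Fin dTA × Fin dTB → ℂ)
    (hθ : ∑ p, Complex.normSq (θ p) = 1)
    (U : (Fin n → Bool) → ((Fin dTA → ℂ) →ₗ[ℂ] (Fin dA × Fin dC → ℂ)))
    (hU : ∀ x v, ∑ p, Complex.normSq (U x v p) = ∑ t, Complex.normSq (v t))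
    (V : (Fin n → Bool) → ((Fin dC × Fin dTB → ℂ) →ₗ[ℂ] (Fin dB → ℂ)))
    (hV : ∀ y v, ∑ b, Complex.normSq (V y v b) = ∑ p, Complex.normSq (v p))
    (out : Fin dB → Bool) (W : Fin n → (Fin n → Bool) → (Fin n → Bool))
    (hW : ∀ j x x', (∀ i < j, x i = x' i) → W j x = W j x')
    (N : ℕ) (hN : N ≤ n) (k : ℕ) (c : ℝ) (hc : 0 ≤ c)
    (hexp : Fintype.card (Fin n → Bool) * c ≤ ∑ x, ∑ j : Fin n with j.val < N,
      bitSign (x j) * owBias θ U V out x (W j x)) :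
    c ^ 2 ^ (k + 1) ≤ 2 * (dC : ℝ) ^ 2 * (N * (2 ^ (k + 1) - 1)) ^ 2 ^ k := by
  set v : (Fin n → Bool) → Fin dA → Fin dC × Fin dTB → ℂ :=
    fun x a ct => U x (fun ta => θ (ta, ct.2)) (a, ct.1) with hv
  set u : Fin dC × Fin dTA → Fin dC × Fin dTB → ℂ :=
    fun q ct => if ct.1 = q.1 then θ (q.2, ct.2) else 0 with hu
  set σ₀ : Matrix (Fin dC × Fin dTB) (Fin dC × Fin dTB) ℂ :=
    ∑ q, vecMulVec (u q) (star (u q)) with hσ₀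
  have hσ₀P : σ₀.PosSemidef := posSemidef_sum_vecMulVec u
  have hσ₀tr : trace σ₀ = ((dC : ℝ) : ℂ) := by
    rw [hσ₀, trace_sum_vecMulVec]
    congr 1
    have : ∀ c : Fin dC, ∑ ta, ∑ ct, Complex.normSq (u (c, ta) ct) = 1 := by
      intro c
      rw [← hθ, Fintype.sum_prod_type]
      refine Finset.sum_congr rfl fun ta _ => ?_
      rw [Fintype.sum_prod_type, Finset.sum_eq_single c]
      · simp [hu]
      · intro c' _ hc'; simp [hu, hc']
      · simp
    rw [Fintype.sum_prod_type]
    simp [this]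
  have hdom : ∀ x w, (star w ⬝ᵥ (∑ a, vecMulVec (v x a) (star (v x a))) *ᵥ w).re ≤
      dC * (star w ⬝ᵥ σ₀ *ᵥ w).re := by
    intro x w
    rw [quadForm_sum_vecMulVec, hσ₀, quadForm_sum_vecMulVec, Complex.ofReal_re,
      Complex.ofReal_re]
    set r : Fin dC → Fin dTA → ℂ := fun c => ∑ t, star (w (c, t)) • fun ta => θ (ta, t) with hr
    have h1 : ∀ a, star w ⬝ᵥ v x a = ∑ c, U x (r c) (a, c) := by
      intro a
      rw [dotProduct, Fintype.sum_prod_type]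
      refine Finset.sum_congr rfl fun c _ => ?_
      rw [hr, map_sum, Finset.sum_apply]
      refine Finset.sum_congr rfl fun t _ => ?_
      rw [map_smul]; rfl
    have h2 : ∀ q, star w ⬝ᵥ u q = r q.1 q.2 := by
      intro q
      rw [dotProduct, Fintype.sum_prod_type, Finset.sum_eq_single q.1]
      · simp [hu, hr]
      · intro c' _ hc'; simp [hu, hc']
      · simp
    simp only [h1, h2, Fintype.sum_prod_type]
    have h3 : ∀ a, Complex.normSq (∑ c, U x (r c) (a, c)) ≤
        dC * ∑ c, Complex.normSq (U x (r c) (a, c)) := by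
      intro a
      simp only [Complex.normSq_eq_norm_sq]
      have := sq_sum_le_card_mul_sum_sq (s := Finset.univ) (f := fun c => ‖U x (r c) (a, c)‖)
      rw [Finset.card_univ, Fintype.card_fin] at this
      exact (pow_le_pow_left₀ (norm_nonneg _) (norm_sum_le _ _) 2).trans this
    refine (Finset.sum_le_sum fun a _ => h3 a).trans ?_
    rw [← Finset.mul_sum, Finset.sum_comm]
    refine mul_le_mul_of_nonneg_left (Finset.sum_le_sum fun c _ => ?_) (Nat.cast_nonneg _)
    rw [← hU x (r c), Fintype.sum_prod_type]
    exact Finset.sum_le_sum fun a _ => Finset.single_le_sum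
      (f := fun c' => Complex.normSq (U x (r c) (a, c'))) (fun _ _ => Complex.normSq_nonneg _)
      (Finset.mem_univ c)
  set η : ℝ := ((dC * dTB : ℕ) + 1 : ℝ)⁻¹ with hη
  have hη0 : 0 < η := by positivity
  set σ : Matrix (Fin dC × Fin dTB) (Fin dC × Fin dTB) ℂ :=
    ((dC : ℝ)⁻¹ : ℝ) • σ₀ + η • (1 : Matrix _ _ ℂ) with hσ
  refine decoding_pow_le (fun j x => LinearMap.toMatrix' (V (W j x)))
    (fun j x x' h => by rw [hW j x x' h])
    (fun j x => conjTranspose_mul_self_eq_one_of_normSq _ fun w => ?_)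
    (fun b => bitSign (out b)) (fun b => ?_) (fun x => ∑ a, vecMulVec (v x a) (star (v x a)))
    (fun x => posSemidef_sum_vecMulVec _) (fun x => ?_) σ ?_ ?_ _ (by positivity) (fun x w => ?_)
    N hN k c hc ?_
  · simpa only [LinearMap.toMatrix'_mulVec] using hV _ w
  · unfold bitSign; split_ifs <;> norm_num
  · rw [trace_sum_vecMulVec, sum_normSq_message θ hθ U hU x, Complex.ofReal_one]
  · exact (PosDef.one.smul hη0).posSemidef_add (hσ₀P.smul (by positivity))
  · rw [hσ, trace_add, trace_smul, trace_smul, hσ₀tr, trace_one]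
    have h1 : (dC : ℝ)⁻¹ * dC ≤ 1 := inv_mul_le_one
    have h2 : η * (dC * dTB : ℕ) ≤ 1 := by
      rw [hη, inv_mul_le_one₀ (by positivity)]; linarith
    simp only [Complex.real_smul, Fintype.card_prod, Fintype.card_fin, Complex.add_re]
    rw [← Complex.ofReal_mul, Complex.ofReal_re, ← Complex.ofReal_natCast, ← Complex.ofReal_mul,
      Complex.ofReal_re]
    linarith
  · refine (hdom x w).trans ?_
    have h1 : star w ⬝ᵥ σ *ᵥ w = ((dC : ℝ)⁻¹ : ℝ) • (star w ⬝ᵥ σ₀ *ᵥ w) +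
        η • (star w ⬝ᵥ w) := by
      rw [hσ, add_mulVec, dotProduct_add, smul_mulVec, smul_mulVec, dotProduct_smul,
        dotProduct_smul, one_mulVec]
    have h2 : 0 ≤ (star w ⬝ᵥ w).re := (Complex.le_def.1 (dotProduct_star_self_nonneg w)).1
    rw [h1, Complex.add_re, Complex.smul_re, Complex.smul_re, smul_eq_mul, smul_eq_mul, mul_add,
      sq, mul_assoc, ← mul_assoc (dC : ℝ) (dC : ℝ)⁻¹]
    have h3 : (dC : ℝ) * ((dC : ℝ) * (dC : ℝ)⁻¹) = dC := by
      rw [← mul_assoc, mul_self_mul_inv]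
    rw [← mul_assoc (dC : ℝ) _ (star w ⬝ᵥ σ₀ *ᵥ w).re, h3]
    have := mul_nonneg (mul_nonneg (Nat.cast_nonneg dC) (Nat.cast_nonneg dC))
      (mul_nonneg hη0.le h2) (α := ℝ)
    linarith
  · refine hexp.trans (le_of_eq (Finset.sum_congr rfl fun x _ =>
      Finset.sum_congr rfl fun j _ => ?_))
    rw [trace_sum_vecMulVec_mul]
    simp only [LinearMap.toMatrix'_mulVec]
    rfl

lemma bitVal_lt_bitVal {n : ℕ} (x y : Fin n → Bool) (j : Fin n) (h : ∀ i < j, x i = y i)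
    (hx : x j = true) (hy : y j = false) : bitVal n y < bitVal n x := by
  have htail : ∑ i : Fin n with j < i, 2 ^ (n - 1 - (i : ℕ)) < 2 ^ (n - 1 - (j : ℕ)) := by
    have hinj : Set.InjOn (fun i : Fin n => n - 1 - (i : ℕ))
        (Finset.univ.filter fun i : Fin n => j < i) := by
      intro a _ b _ hab
      have := a.isLt
      have := b.isLt
      ext
      simp only at hab
      omega
    rw [← Finset.sum_image (f := fun k => 2 ^ k) (g := fun i : Fin n => n - 1 - (i : ℕ)) hinj]
    refine Nat.geomSum_lt le_rfl fun k hk => ?_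
    obtain ⟨i, hi, rfl⟩ := Finset.mem_image.1 hk
    have h1 := (Finset.mem_filter.1 hi).2
    have := i.isLt
    rw [Fin.lt_def] at h1
    omega
  have hyle : bitVal n y ≤ ∑ i : Fin n, ((if i < j then if x i then 2 ^ (n - 1 - (i : ℕ)) else 0
      else 0) + if j < i then 2 ^ (n - 1 - (i : ℕ)) else 0) := by
    refine Finset.sum_le_sum fun i _ => ?_
    rcases lt_trichotomy i j with hi | rfl | hi
    · simp [hi, h i hi]
    · simp [hy]
    · simp only [hi, hi.not_gt, if_true, if_false]; split_ifs <;> simp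
  have hxge : ∑ i : Fin n, ((if i < j then if x i then 2 ^ (n - 1 - (i : ℕ)) else 0
      else 0) + if i = j then 2 ^ (n - 1 - (i : ℕ)) else 0) ≤ bitVal n x := by
    refine Finset.sum_le_sum fun i _ => ?_
    rcases lt_trichotomy i j with hi | rfl | hi
    · simp [hi, hi.ne]
    · simp [hx]
    · simp [hi.not_gt, hi.ne']
  rw [Finset.sum_add_distrib, ← Finset.sum_filter (p := fun i => j < i)] at hyle
  rw [Finset.sum_add_distrib, Finset.sum_ite_eq' Finset.univ j, if_pos (Finset.mem_univ j)] at hxge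
  omega

lemma GT_eq_of_ne {n : ℕ} (x y : Fin n → Bool) (j : Fin n) (h : ∀ i < j, x i = y i)
    (hne : x j ≠ y j) : GT n (x, y) = x j := by
  cases hx : x j
  · have := bitVal_lt_bitVal y x j (fun i hi => (h i hi).symm) (by grind) hx
    simpa [GT] using this
  · have := bitVal_lt_bitVal x y j h hx (by grind)
    simpa [GT] using this.le

lemma bitVal_flipBit {n : ℕ} (x : Fin n → Bool) (j : Fin n) :
    bitVal n (flipBit j x) + (if x j then 2 ^ (n - 1 - (j : ℕ)) else 0) =
      bitVal n x + if x j then 0 else 2 ^ (n - 1 - (j : ℕ)) := by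
  unfold bitVal
  rw [← Finset.add_sum_erase _ _ (Finset.mem_univ j),
    ← Finset.add_sum_erase (a := j) _ (fun i => if x i then 2 ^ (n - 1 - (i : ℕ)) else 0)
      (Finset.mem_univ j), flipBit_self]
  have : ∑ i ∈ Finset.univ.erase j, (if flipBit j x i then 2 ^ (n - 1 - (i : ℕ)) else 0) =
      ∑ i ∈ Finset.univ.erase j, if x i then 2 ^ (n - 1 - (i : ℕ)) else 0 :=
    Finset.sum_congr rfl fun i hi => by rw [flipBit_of_ne (Finset.ne_of_mem_erase hi)]
  rw [this]
  cases x j <;> simp [add_comm]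

lemma GT_flipBit {n : ℕ} (x y : Fin n → Bool) (j : Fin n) (h : x j = y j) :
    GT n (flipBit j x, flipBit j y) = GT n (x, y) := by
  have h1 := bitVal_flipBit x j
  have h2 := bitVal_flipBit y j
  rw [← h] at h2
  unfold GT
  congr 1
  apply propext
  simp only
  omega

/-- The string that agrees with `x` on the coordinates below `m` and with `z` elsewhere. -/
def mixBits {n : ℕ} (m : ℕ) (x z : Fin n → Bool) : Fin n → Bool :=
  fun i => if (i : ℕ) < m then x i else z i

lemma mixBits_flipBit {n : ℕ} (j : Fin n) (x z : Fin n → Bool) :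
    mixBits j (flipBit j x) (flipBit j z) = flipBit j (mixBits j x z) := by
  ext i
  unfold mixBits flipBit
  by_cases h : i = j
  · subst h; simp
  · simp [Function.update_of_ne h]

lemma sum_ite_ne {n : ℕ} (j : Fin n) (b : Bool) :
    ∑ z : Fin n → Bool, (if b ≠ z j then (2 : ℝ) else 0) = Fintype.card (Fin n → Bool) := by
  have h := sum_flipBit j (fun z : Fin n → Bool => if b ≠ z j then (2 : ℝ) else 0)
  have h2 : ∑ z : Fin n → Bool, ((if b ≠ z j then (2 : ℝ) else 0) +
      if b ≠ flipBit j z j then (2 : ℝ) else 0) = ∑ z : Fin n → Bool, 2 := by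
    refine Finset.sum_congr rfl fun z _ => ?_
    rw [flipBit_self]
    cases b <;> cases z j <;> simp
  rw [Finset.sum_add_distrib, h, Finset.sum_const, Finset.card_univ, nsmul_eq_mul] at h2
  linarith

lemma sum_bitSign_mul_GT {n : ℕ} (j : Fin n) :
    ∑ x : Fin n → Bool, ∑ z : Fin n → Bool,
      bitSign (x j) * bitSign (GT n (x, mixBits j x z)) =
      (Fintype.card (Fin n → Bool) : ℝ) ^ 2 / 2 := by
  set F : (Fin n → Bool) → (Fin n → Bool) → ℝ := fun x z =>
    bitSign (x j) * bitSign (GT n (x, mixBits j x z)) with hF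
  have hagree : ∀ x z : Fin n → Bool, ∀ i < j, x i = mixBits j x z i := by
    intro x z i hi
    rw [mixBits, if_pos (Fin.lt_def.1 hi)]
  have hself : ∀ x z : Fin n → Bool, mixBits j x z j = z j := by
    intro x z; rw [mixBits, if_neg (lt_irrefl _)]
  have hne : ∀ x z : Fin n → Bool, x j ≠ z j → F x z = 1 := by
    intro x z h
    simp only [hF]
    rw [GT_eq_of_ne x _ j (hagree x z) (by rwa [hself])]
    unfold bitSign; split_ifs <;> norm_num
  have hpt : ∀ x z, F x z + F (flipBit j x) (flipBit j z) = if x j ≠ z j then 2 else 0 := by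
    intro x z
    split_ifs with h
    · rw [hne x z h, hne _ _ (by rw [flipBit_self, flipBit_self]; simpa using h)]; norm_num
    · push Not at h
      simp only [hF]
      rw [mixBits_flipBit, GT_flipBit _ _ _ (by rw [hself, h]), flipBit_self, bitSign_not]
      ring
  have h1 : ∑ x, ∑ z, F (flipBit j x) (flipBit j z) = ∑ x, ∑ z, F x z := by
    rw [sum_flipBit j (fun x => ∑ z, F x (flipBit j z))]
    exact Finset.sum_congr rfl fun x _ => sum_flipBit j (F x)
  have h2 : ∑ x, ∑ z, (F x z + F (flipBit j x) (flipBit j z)) =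
      (Fintype.card (Fin n → Bool) : ℝ) ^ 2 := by
    simp only [hpt, sum_ite_ne, Finset.sum_const, Finset.card_univ, nsmul_eq_mul, sq]
  simp only [Finset.sum_add_distrib, h1] at h2
  linarith

lemma card_mixBits_eq {n : ℕ} (m : ℕ) : ∃ K : ℕ, ∀ x y : Fin n → Bool,
    (Finset.univ.filter fun z => mixBits m x z = y).card =
      if (∀ i : Fin n, (i : ℕ) < m → x i = y i) then K else 0 := by
  refine ⟨∏ i : Fin n, if (i : ℕ) < m then 2 else 1, fun x y => ?_⟩
  split_ifs with h
  · have : (Finset.univ.filter fun z => mixBits m x z = y) =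
        Fintype.piFinset fun i : Fin n => if (i : ℕ) < m then Finset.univ else {y i} := by
      ext z
      simp only [Finset.mem_filter, Finset.mem_univ, true_and, Fintype.mem_piFinset, funext_iff]
      refine forall_congr' fun i => ?_
      unfold mixBits
      split_ifs with hi
      · simp [h i hi]
      · simp
    rw [this, Fintype.card_piFinset]
    refine Finset.prod_congr rfl fun i _ => ?_
    split_ifs <;> simp
  · rw [Finset.card_eq_zero, Finset.filter_eq_empty_iff]
    rintro z - rfl
    exact h fun i hi => by rw [mixBits, if_pos hi]

lemma sum_agreeBelow {n : ℕ} (j : Fin (n / 2)) (f : (Fin n → Bool) → (Fin n → Bool) → ℝ) :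
    ∑ x, ∑ y, (if agreeBelow n (x, y) j then
      (((Finset.univ.filter (fun q' : (Fin n → Bool) × (Fin n → Bool) =>
        agreeBelow n q' j)).card : ℝ))⁻¹ else 0) * f x y =
    ((Fintype.card (Fin n → Bool) : ℝ) ^ 2)⁻¹ * ∑ x, ∑ z, f x (mixBits j x z) := by
  obtain ⟨K, hK⟩ := card_mixBits_eq (n := n) j
  have hfib : ∀ (g : (Fin n → Bool) → (Fin n → Bool) → ℝ), ∑ x, ∑ z, g x (mixBits j x z) =
      K * ∑ x, ∑ y, if agreeBelow n (x, y) j then g x y else 0 := by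
    intro g
    rw [Finset.mul_sum]
    refine Finset.sum_congr rfl fun x _ => ?_
    have h1 : ∀ z, g x (mixBits j x z) = ∑ y, if mixBits j x z = y then g x y else 0 := by
      intro z; simp
    simp only [h1]
    rw [Finset.sum_comm, Finset.mul_sum]
    refine Finset.sum_congr rfl fun y _ => ?_
    rw [← Finset.sum_filter, Finset.sum_const, nsmul_eq_mul, hK x y]
    unfold agreeBelow
    simp only
    split_ifs <;> simp
  have hC : (Fintype.card (Fin n → Bool) : ℝ) ^ 2 =
      K * (Finset.univ.filter (fun q' : (Fin n → Bool) × (Fin n → Bool) =>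
        agreeBelow n q' j)).card := by
    have := hfib fun _ _ => 1
    rw [← Fintype.sum_prod_type' (f := fun x y => if agreeBelow n (x, y) j then (1 : ℝ) else 0),
      Finset.sum_boole] at this
    rw [← this]
    simp [sq]
  have hM : (Fintype.card (Fin n → Bool) : ℝ) ^ 2 ≠ 0 := by
    have : Fintype.card (Fin n → Bool) ≠ 0 := Fintype.card_ne_zero
    positivity
  rw [hfib, hC]
  rw [hC] at hM
  have hK0 : (K : ℝ) ≠ 0 := left_ne_zero_of_mul hM
  rw [mul_inv, mul_comm (K : ℝ)⁻¹, mul_assoc, inv_mul_cancel_left₀ hK0, Finset.mul_sum]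
  refine Finset.sum_congr rfl fun x _ => ?_
  rw [Finset.mul_sum]
  exact Finset.sum_congr rfl fun y _ => by split_ifs <;> simp

lemma sum_gtNu_mul {n : ℕ} (f : (Fin n → Bool) → (Fin n → Bool) → ℝ) :
    ∑ x, ∑ y, gtNu n (x, y) * f x y =
      ((n / 2 : ℕ) : ℝ)⁻¹ * ∑ j : Fin (n / 2), ((Fintype.card (Fin n → Bool) : ℝ) ^ 2)⁻¹ *
        ∑ x, ∑ z, f x (mixBits j x z) := by
  simp_rw [← sum_agreeBelow]
  simp only [gtNu, mul_assoc, Finset.sum_mul, ← Finset.mul_sum]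
  congr 1
  rw [Finset.sum_comm (γ := Fin (n / 2))]
  exact Finset.sum_congr rfl fun x _ => Finset.sum_comm

lemma sum_filter_val_lt {n N : ℕ} (hN : N ≤ n) (f : Fin n → ℝ) :
    ∑ j : Fin n with j.val < N, f j = ∑ j : Fin N, f (Fin.castLE hN j) := by
  symm
  refine Finset.sum_bij (fun j _ => Fin.castLE hN j) (by simp) (by simp) ?_ (by simp)
  intro b hb
  exact ⟨⟨b, (Finset.mem_filter.1 hb).2⟩, Finset.mem_univ _, rfl⟩

lemma bias_ge_of_mass {ι κ : Type} [Fintype ι] [Fintype κ] (p : ι → κ → ℝ)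
    (hp : ∀ a b, 0 ≤ p a b) (hp1 : ∑ a, ∑ b, p a b = 1) (out : κ → Bool) (g t : Bool) :
    bitSign t * bitSign g - 2 * (1 - ∑ a, ∑ b, if out b = g then p a b else 0) ≤
      bitSign t * ∑ a, ∑ b, bitSign (out b) * p a b := by
  set S := ∑ a, ∑ b, if out b = g then p a b else 0 with hS
  have hS1 : S ≤ 1 := by
    rw [← hp1]
    refine Finset.sum_le_sum fun a _ => Finset.sum_le_sum fun b _ => ?_
    split_ifs
    exacts [le_rfl, hp a b]
  have hE : ∑ a, ∑ b, bitSign (out b) * p a b = bitSign g * (2 * S - 1) := by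
    rw [← hp1, hS]
    simp only [Finset.mul_sum, ← Finset.sum_sub_distrib]
    refine Finset.sum_congr rfl fun a _ => Finset.sum_congr rfl fun b _ => ?_
    unfold bitSign
    cases out b <;> cases g <;> simp <;> ring
  rw [hE]
  unfold bitSign
  cases t <;> cases g <;> simp <;> linarith

lemma exists_suffix_bias_ge {n dTA dTB dA dC dB : ℕ} (hn : 0 < n / 2) (θ : Fin dTA × Fin dTB → ℂ)
    (hθ : ∑ p, Complex.normSq (θ p) = 1)
    (U : (Fin n → Bool) → ((Fin dTA → ℂ) →ₗ[ℂ] (Fin dA × Fin dC → ℂ)))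
    (hU : ∀ x v, ∑ p, Complex.normSq (U x v p) = ∑ t, Complex.normSq (v t))
    (V : (Fin n → Bool) → ((Fin dC × Fin dTB → ℂ) →ₗ[ℂ] (Fin dB → ℂ)))
    (hV : ∀ y v, ∑ b, Complex.normSq (V y v b) = ∑ p, Complex.normSq (v p))
    (out : Fin dB → Bool) (ε : ℝ) (h : 1 - ε ≤ owSuccess θ U V out (gtNu n) (GT n)) :
    ∃ z : Fin n → Bool, Fintype.card (Fin n → Bool) * ((n / 2 : ℕ) * (1 / 2 - 2 * ε)) ≤
      ∑ x, ∑ j : Fin n with j.val < n / 2, bitSign (x j) * owBias θ U V out x (mixBits j x z) := by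
  set M : ℝ := (Fintype.card (Fin n → Bool) : ℝ) with hM
  set N := n / 2 with hN
  have hNn : N ≤ n := Nat.div_le_self _ _
  have hM0 : 0 < M := by rw [hM]; exact_mod_cast Fintype.card_pos
  have hN0 : (0 : ℝ) < N := by exact_mod_cast hn
  set S : (Fin n → Bool) → (Fin n → Bool) → ℝ := fun x y => ∑ a : Fin dA, ∑ b : Fin dB,
      if out b = GT n (x, y) then
        Complex.normSq (V y (fun ct => U x (fun ta => θ (ta, ct.2)) (a, ct.1)) b) else 0 with hS
  have hsucc : (1 - ε) * (N * M ^ 2) ≤ ∑ j : Fin N, ∑ x, ∑ z, S x (mixBits j x z) := by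
    have h1 : owSuccess θ U V out (gtNu n) (GT n) = ∑ x, ∑ y, gtNu n (x, y) * S x y := rfl
    rw [h1, sum_gtNu_mul, ← Finset.mul_sum, ← mul_assoc, ← mul_inv, inv_mul_eq_div,
      le_div_iff₀ (by positivity)] at h
    exact h
  have hpt : ∀ (x y : Fin n → Bool) (j : Fin n),
      bitSign (x j) * bitSign (GT n (x, y)) - 2 * (1 - S x y) ≤
        bitSign (x j) * owBias θ U V out x y := by
    intro x y j
    refine bias_ge_of_mass (fun a b =>
      Complex.normSq (V y (fun ct => U x (fun ta => θ (ta, ct.2)) (a, ct.1)) b))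
      (fun _ _ => Complex.normSq_nonneg _) ?_ out (GT n (x, y)) (x j)
    simp only [hV]
    exact sum_normSq_message θ hθ U hU x
  have htot : M * (M * (N * (1 / 2 - 2 * ε))) ≤ ∑ z, ∑ x, ∑ j : Fin n with j.val < N,
      bitSign (x j) * owBias θ U V out x (mixBits j x z) := by
    have h1 : ∑ z, ∑ x, ∑ j : Fin n with j.val < N,
        bitSign (x j) * owBias θ U V out x (mixBits j x z) =
        ∑ j : Fin N, ∑ x, ∑ z, bitSign (x (Fin.castLE hNn j)) *
          owBias θ U V out x (mixBits j x z) := by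
      simp only [sum_filter_val_lt hNn]
      rw [Finset.sum_comm, Finset.sum_comm (γ := Fin N)]
      exact Finset.sum_congr rfl fun x _ => Finset.sum_comm
    rw [h1]
    have h2 : ∀ j : Fin N, M ^ 2 / 2 - 2 * (M ^ 2 - ∑ x, ∑ z, S x (mixBits j x z)) ≤
        ∑ x, ∑ z, bitSign (x (Fin.castLE hNn j)) * owBias θ U V out x (mixBits j x z) := by
      intro j
      refine le_trans (le_of_eq ?_) (Finset.sum_le_sum fun x _ => Finset.sum_le_sum fun z _ =>
        hpt x (mixBits j x z) (Fin.castLE hNn j))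
      simp only [Finset.sum_sub_distrib, ← Finset.mul_sum]
      have h3 := sum_bitSign_mul_GT (Fin.castLE hNn j)
      simp only [← hM, Finset.mul_sum, Fin.val_castLE] at h3 ⊢
      rw [h3]
      simp only [Finset.sum_const, Finset.card_univ, nsmul_eq_mul, ← hM]
      ring
    refine le_trans ?_ (Finset.sum_le_sum fun j _ => h2 j)
    simp only [Finset.sum_sub_distrib, ← Finset.mul_sum, Finset.sum_const, Finset.card_univ,
      nsmul_eq_mul, Fintype.card_fin]
    linarith
  by_contra! hlt
  have := Finset.sum_lt_sum_of_nonempty Finset.univ_nonempty fun z (_ : z ∈ Finset.univ) => hlt z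
  rw [Finset.sum_const, Finset.card_univ, nsmul_eq_mul, ← hM] at this
  linarith

lemma div_le_logb_of_pow_le (N d : ℕ) (hN : 11 ≤ N) (h : ∀ k : ℕ,
    ((N : ℝ) * (9 / 20)) ^ 2 ^ (k + 1) ≤ 2 * (d : ℝ) ^ 2 * (N * (2 ^ (k + 1) - 1)) ^ 2 ^ k) :
    (N : ℝ) / 160 ≤ Real.logb 2 d := by
  have hN' : (11 : ℝ) ≤ N := by exact_mod_cast hN
  have hd : 2 ≤ d := by
    by_contra! hd
    have hd1 : (d : ℝ) ^ 2 ≤ 1 := pow_le_one₀ (by positivity)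
      (by exact_mod_cast Nat.le_of_lt_succ hd)
    have h0 := h 0
    norm_num at h0
    nlinarith
  have hd' : (2 : ℝ) ≤ d := by exact_mod_cast hd
  have hlog1 : 1 ≤ Real.logb 2 d := by
    rw [Real.le_logb_iff_rpow_le (by norm_num) (by linarith)]; simpa using hd'
  by_cases hN40 : N < 40
  · have : (N : ℝ) < 40 := by exact_mod_cast hN40
    linarith
  push Not at hN40
  obtain ⟨k, hk1, hk2⟩ : ∃ k : ℕ, 2 ^ (k + 1) * 20 ≤ N ∧ N < 2 ^ (k + 1) * 40 := by
    refine ⟨Nat.log 2 (N / 20) - 1, ?_, ?_⟩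
    all_goals
      have h1 : 1 ≤ Nat.log 2 (N / 20) := Nat.log_pos (by norm_num) (by omega)
      rw [Nat.sub_add_cancel h1]
    · have := Nat.pow_log_le_self 2 (x := N / 20) (by omega)
      omega
    · have := Nat.lt_pow_succ_log_self (b := 2) (by norm_num) (N / 20)
      rw [pow_succ] at this
      omega
  have hk1' : (2 : ℝ) ^ (k + 1) * 20 ≤ N := by exact_mod_cast hk1
  have hk2' : (N : ℝ) < 2 ^ (k + 1) * 40 := by exact_mod_cast hk2
  have hp : (1 : ℝ) ≤ 2 ^ (k + 1) := one_le_pow₀ (by norm_num)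
  have hpow : (2 : ℝ) ^ 2 ^ (k + 1) ≤ 2 * (d : ℝ) ^ 2 := by
    have h1 := h k
    set P : ℝ := N * (2 ^ (k + 1) - 1) with hP
    have hP0 : 0 < P := by
      refine mul_pos (by linarith) ?_
      have : (1 : ℝ) < 2 ^ (k + 1) := one_lt_pow₀ (by norm_num) (by simp)
      linarith
    have h2 : 4 * P ≤ (N * (9 / 20)) ^ 2 := by rw [hP]; nlinarith
    have h3 : (4 * P) ^ 2 ^ k ≤ (N * (9 / 20)) ^ 2 ^ (k + 1) := by
      rw [pow_succ' 2 k, pow_mul]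
      exact pow_le_pow_left₀ (by positivity) h2 _
    rw [mul_pow] at h3
    have h4 : (2 : ℝ) ^ 2 ^ (k + 1) = 4 ^ 2 ^ k := by
      rw [pow_succ' 2 k, pow_mul]; norm_num
    rw [h4]
    exact le_of_mul_le_mul_right (h3.trans h1) (by positivity)
  have hlog := Real.logb_le_logb_of_le (b := 2) (by norm_num) (by positivity) hpow
  rw [Real.logb_pow, Real.logb_mul (by norm_num) (by positivity), Real.logb_pow,
    Real.logb_self_eq_one (by norm_num)] at hlog
  push_cast at hlog
  linarith

/-- **One-way lower bound for Greater-Than.**  There are constants `ε₀ ∈ (0, 1/2)` and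
`c₀ > 0` such that for every even `n > 20`, every entanglement-assisted one-way quantum
protocol computing Greater-Than with average error at most `ε₀` over the hard
distribution `ν` must send at least `c₀ · n` qubits. -/
theorem gt_one_way_lower_bound :
    ∃ ε₀ c₀ : ℝ, 0 < ε₀ ∧ ε₀ < 1 / 2 ∧ 0 < c₀ ∧
      ∀ n : ℕ, 20 < n → n % 2 = 0 →
        ∀ dTA dTB dA dC dB : ℕ,
          ∀ θ : Fin dTA × Fin dTB → ℂ, (∑ p, Complex.normSq (θ p) = 1) →
          ∀ U : (Fin n → Bool) → ((Fin dTA → ℂ) →ₗ[ℂ] (Fin dA × Fin dC → ℂ)),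
            (∀ x v, ∑ p, Complex.normSq (U x v p) = ∑ t, Complex.normSq (v t)) →
          ∀ V : (Fin n → Bool) → ((Fin dC × Fin dTB → ℂ) →ₗ[ℂ] (Fin dB → ℂ)),
            (∀ y v, ∑ b, Complex.normSq (V y v b) = ∑ p, Complex.normSq (v p)) →
          ∀ out : Fin dB → Bool,
            1 - ε₀ ≤ owSuccess θ U V out (gtNu n) (GT n) →
            c₀ * n ≤ Real.logb 2 dC := by
  refine ⟨1 / 40, 1 / 320, by norm_num, by norm_num, by norm_num, ?_⟩
  intro n hn heven dTA dTB dA dC dB θ hθ U hU V hV out hsucc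
  obtain ⟨z, hz⟩ := exists_suffix_bias_ge (by omega) θ hθ U hU V hV out _ hsucc
  have hn2 : ((n / 2 : ℕ) : ℝ) = n / 2 := by
    rw [Nat.cast_div (Nat.dvd_of_mod_eq_zero heven) (by norm_num)]; norm_num
  have h := div_le_logb_of_pow_le (n / 2) dC (by omega) fun k =>
    protocol_pow_le θ hθ U hU V hV out (fun j x => mixBits j x z)
      (fun j x x' hx => by
        ext i
        unfold mixBits
        split_ifs with hi
        · rw [hx i hi]
        · rfl)
      (n / 2) (Nat.div_le_self _ _) k _ (by positivity)
      (hz.trans' (le_of_eq (by norm_num)))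
  rw [hn2] at h
  linarith

end GTOneWay
end
end

section
/- Quantum Shearer lemma: Let U₁, …, U_m and V be finite types, U = U₁ × ⋯ × U_m, and let Ψ be a quantum state on U × V whose marginal on U is a tensor product: Ψ_{U₁⋯U_m} = Ψ_{U₁} ⊗ Ψ_{U₂} ⊗ ⋯ ⊗ Ψ_{U_m}. Let k > 0 be a real number and let ν be a probability distribution on subsets s ⊆ {1,…,m} such that for every i ∈ {1,…,m}, Pr_{s←ν}[i ∈ s] ≤ 1/k. For a subset s, let I(U_s ; V)_Ψ denote the mutual information computed on the marginal of Ψ on (∏_{i∈s} U_i) × V. Then E_{s←ν}[ I(U_s ; V)_Ψ ] ≤ I(U ; V)_Ψ / k. -/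
open scoped BigOperators Classical ComplexOrder

noncomputable section

namespace QI

/-- Partial trace over the left factor. -/
def ptraceLeft {α β : Type} [Fintype α] (ρ : Matrix (α × β) (α × β) ℂ) : Matrix β β ℂ :=
  Matrix.of fun b b' => ∑ a : α, ρ (a, b) (a, b')

/-- Partial trace over the right factor. -/
def ptraceRight {α β : Type} [Fintype β] (ρ : Matrix (α × β) (α × β) ℂ) : Matrix α α ℂ :=
  Matrix.of fun a a' => ∑ b : β, ρ (a, b) (a', b)

/-- Von Neumann entropy (natural logarithm), via eigenvalues. -/
def entropy {ι : Type} [Fintype ι] (ρ : Matrix ι ι ℂ) : ℝ :=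
  if h : ρ.IsHermitian then -∑ i, (h.eigenvalues i) * Real.log (h.eigenvalues i) else 0

/-- Mutual information `I(α;β)` of a state on `α × β`. -/
def mutInfoM {α β : Type} [Fintype α] [Fintype β]
    (ρ : Matrix (α × β) (α × β) ℂ) : ℝ :=
  entropy (ptraceRight ρ) + entropy (ptraceLeft ρ) - entropy ρ

/-- Glue an assignment on the coordinates in `s` and one on the coordinates
outside of `s` into a full assignment. -/
def glue {m : ℕ} {U : Fin m → Type} (s : Finset (Fin m))
    (a : ∀ i : {j : Fin m // j ∈ s}, U i.1) (u : ∀ i : {j : Fin m // j ∉ s}, U i.1) :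
    ∀ i, U i :=
  fun i => if h : i ∈ s then a ⟨i, h⟩ else u ⟨i, h⟩

/-- The marginal of a state on `(∀ i, U i) × V` on the coordinates
`U_s` (for `s` a subset of the indices) together with `V`. -/
def marginSub {m : ℕ} {U : Fin m → Type} [∀ i, Fintype (U i)] {V : Type} [Fintype V]
    (Ψ : Matrix ((∀ i, U i) × V) ((∀ i, U i) × V) ℂ) (s : Finset (Fin m)) :
    Matrix ((∀ i : {j : Fin m // j ∈ s}, U i.1) × V)
      ((∀ i : {j : Fin m // j ∈ s}, U i.1) × V) ℂ :=
  Matrix.of fun p q => ∑ u : (∀ i : {j : Fin m // j ∉ s}, U i.1),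
    Ψ (glue s p.1 u, p.2) (glue s q.1 u, q.2)

open scoped Matrix Kronecker

section Entropy

variable {n : Type} [Fintype n]

theorem exists_unitary_diagonal [DecidableEq n] {ρ : Matrix n n ℂ} (hρ : ρ.PosSemidef) :
    ∃ (P : Matrix n n ℂ) (l : n → ℝ), (∀ i, 0 ≤ l i) ∧ Pᴴ * P = 1 ∧ P * Pᴴ = 1 ∧
      ρ = P * Matrix.diagonal (fun i => (l i : ℂ)) * Pᴴ := by
  refine ⟨hρ.1.eigenvectorUnitary, hρ.1.eigenvalues, hρ.eigenvalues_nonneg, ?_, ?_, ?_⟩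
  · exact (Matrix.mem_unitaryGroup_iff').1 hρ.1.eigenvectorUnitary.2
  · exact (Matrix.mem_unitaryGroup_iff).1 hρ.1.eigenvectorUnitary.2
  · exact hρ.1.spectral_theorem

theorem entropy_eq_roots [DecidableEq n] {ρ : Matrix n n ℂ} (h : ρ.IsHermitian) :
    entropy ρ = -(ρ.charpoly.roots.map fun z => z.re * Real.log z.re).sum := by
  obtain rfl : ‹DecidableEq n› = fun a b => Classical.propDecidable (a = b) :=
    Subsingleton.elim _ _
  rw [h.roots_charpoly_eq_eigenvalues, entropy, dif_pos h]
  simp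

theorem entropy_submatrix {m : Type} [Fintype m] (ρ : Matrix n n ℂ) (e : m ≃ n) :
    entropy (ρ.submatrix e e) = entropy ρ := by
  by_cases h : ρ.IsHermitian
  · rw [entropy_eq_roots h, entropy_eq_roots (h.submatrix e)]
    have := Matrix.charpoly_reindex e.symm ρ
    rw [Matrix.reindex_apply, Equiv.symm_symm] at this
    rw [this]
  · have h' : ¬ (ρ.submatrix e e).IsHermitian := fun h' => h <| by
      simpa using h'.submatrix e.symm
    rw [entropy, entropy, dif_neg h, dif_neg h']

theorem entropy_unitary_diagonal [DecidableEq n] {P : Matrix n n ℂ} (l : n → ℝ)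
    (hP : Pᴴ * P = 1) :
    entropy (P * Matrix.diagonal (fun i => (l i : ℂ)) * Pᴴ) = -∑ i, l i * Real.log (l i) := by
  have hd : (Matrix.diagonal (fun i => (l i : ℂ))).IsHermitian :=
    Matrix.isHermitian_diagonal_of_self_adjoint _ (by ext; simp)
  rw [entropy_eq_roots (Matrix.isHermitian_mul_mul_conjTranspose P hd), Matrix.charpoly_mul_comm,
    ← mul_assoc, hP, one_mul, Matrix.charpoly_diagonal, Polynomial.roots_prod]
  · simp
  · simp [Finset.prod_ne_zero_iff, Polynomial.X_sub_C_ne_zero]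

theorem entropy_of_unique [Unique n] {ρ : Matrix n n ℂ} (h : ρ.trace = 1) : entropy ρ = 0 := by
  have : ρ = 1 * Matrix.diagonal (fun _ => ((1 : ℝ) : ℂ)) * (1 : Matrix n n ℂ)ᴴ := by
    ext i j
    obtain rfl := Subsingleton.elim i default
    obtain rfl := Subsingleton.elim j default
    simpa [Matrix.trace] using h
  rw [this, entropy_unitary_diagonal _ (by simp)]
  simp

theorem entropy_kronecker {m : Type} [Fintype m] {ρ : Matrix n n ℂ} {τ : Matrix m m ℂ}
    (hρ : ρ.PosSemidef) (hτ : τ.PosSemidef) (hρ1 : ρ.trace = 1) (hτ1 : τ.trace = 1) :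
    entropy (ρ ⊗ₖ τ) = entropy ρ + entropy τ := by
  obtain ⟨P, l, -, hP, -, rfl⟩ := exists_unitary_diagonal hρ
  obtain ⟨W, k, -, hW, -, rfl⟩ := exists_unitary_diagonal hτ
  have hl : ∑ i, l i = 1 := by
    rw [Matrix.trace_mul_comm, ← mul_assoc, hP, one_mul, Matrix.trace_diagonal] at hρ1
    exact_mod_cast hρ1
  have hk : ∑ i, k i = 1 := by
    rw [Matrix.trace_mul_comm, ← mul_assoc, hW, one_mul, Matrix.trace_diagonal] at hτ1
    exact_mod_cast hτ1
  have hPW : (P ⊗ₖ W)ᴴ * (P ⊗ₖ W) = 1 := by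
    rw [Matrix.conjTranspose_kronecker, ← Matrix.mul_kronecker_mul, hP, hW,
      Matrix.one_kronecker_one]
  have hd : (P * Matrix.diagonal (fun i => (l i : ℂ)) * Pᴴ) ⊗ₖ
      (W * Matrix.diagonal (fun i => (k i : ℂ)) * Wᴴ) =
      (P ⊗ₖ W) * Matrix.diagonal (fun x : n × m => ((l x.1 * k x.2 : ℝ) : ℂ)) * (P ⊗ₖ W)ᴴ := by
    rw [Matrix.mul_kronecker_mul, Matrix.mul_kronecker_mul, Matrix.diagonal_kronecker_diagonal,
      Matrix.conjTranspose_kronecker]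
    push_cast
    rfl
  rw [hd, entropy_unitary_diagonal _ hPW, entropy_unitary_diagonal _ hP,
    entropy_unitary_diagonal _ hW, Fintype.sum_prod_type, ← neg_add]
  have key : ∀ i j, l i * k j * Real.log (l i * k j) =
      k j * (l i * Real.log (l i)) + l i * (k j * Real.log (k j)) := fun i j => by
    rcases eq_or_ne (l i) 0 with h | h
    · simp [h]
    rcases eq_or_ne (k j) 0 with h' | h'
    · simp [h']
    rw [Real.log_mul h h']
    ring
  simp only [key, Finset.sum_add_distrib, ← Finset.sum_mul, ← Finset.mul_sum, hk, one_mul, hl]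

end Entropy

section RelativeEntropy

open Filter Topology

/-- The finite sum `∑ w λ (log λ - log μ)` is monotone under the order given by the resolvent
sums `∑ w λ² / (μ + t λ)`. -/
theorem sum_mul_log_sub_log_le {I J : Type} [Fintype I] [Fintype J]
    {w l k : I → ℝ} {w' l' k' : J → ℝ}
    (hl : ∀ i, 0 ≤ l i) (hk : ∀ i, 0 ≤ k i)
    (hs : ∀ i, w i ≠ 0 → l i ≠ 0 → k i ≠ 0)
    (hl' : ∀ i, 0 ≤ l' i) (hk' : ∀ i, 0 ≤ k' i)
    (hs' : ∀ i, w' i ≠ 0 → l' i ≠ 0 → k' i ≠ 0)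
    (htr : ∑ i, w' i * l' i = ∑ i, w i * l i)
    (hQ : ∀ t : ℝ, 0 < t → ∑ i, w' i * (l' i ^ 2 / (k' i + t * l' i)) ≤
      ∑ i, w i * (l i ^ 2 / (k i + t * l i))) :
    ∑ i, w' i * l' i * (Real.log (l' i) - Real.log (k' i)) ≤
      ∑ i, w i * l i * (Real.log (l i) - Real.log (k i)) := by
  let F : ∀ {K : Type} [Fintype K], (K → ℝ) → (K → ℝ) → (K → ℝ) → ℝ → ℝ :=
    fun w l k T => ∑ i, w i * l i * (Real.log (k i + T * l i) - Real.log (k i))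
  have hF : ∀ {K : Type} [Fintype K] (w l k : K → ℝ), (∀ i, 0 ≤ l i) → (∀ i, 0 ≤ k i) →
      (∀ i, w i ≠ 0 → l i ≠ 0 → k i ≠ 0) → ∀ T : ℝ, 0 ≤ T →
      HasDerivAt (F w l k) (∑ i, w i * (l i ^ 2 / (k i + T * l i))) T := by
    intro K _ w l k hl hk hs T hT
    refine HasDerivAt.fun_sum fun i _ => ?_
    rcases eq_or_ne (w i) 0 with h | h
    · simpa [h] using hasDerivAt_const T (0 : ℝ)
    rcases eq_or_ne (l i) 0 with h' | h'
    · simpa [h'] using hasDerivAt_const T (0 : ℝ)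
    have hkp : 0 < k i := (hk i).lt_of_ne' (hs i h h')
    have hp : 0 < k i + T * l i := by have := hl i; positivity
    have h1 : HasDerivAt (fun T => k i + T * l i) (l i) T := by
      simpa using ((hasDerivAt_id T).mul_const (l i)).const_add (k i)
    have h2 := ((h1.log hp.ne').sub_const (Real.log (k i))).const_mul (w i * l i)
    exact h2.congr_deriv (by ring)
  have hlim : ∀ {K : Type} [Fintype K] (w l k : K → ℝ), (∀ i, 0 ≤ l i) →
      Tendsto (fun T => F w l k T - (∑ i, w i * l i) * Real.log T) atTop
        (𝓝 (∑ i, w i * l i * (Real.log (l i) - Real.log (k i)))) := by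
    intro K _ w l k hl
    have : (fun T => F w l k T - (∑ i, w i * l i) * Real.log T) =
        fun T => ∑ i, w i * l i * ((Real.log (k i + T * l i) - Real.log T) - Real.log (k i)) := by
      ext T
      simp only [F, Finset.sum_mul, ← Finset.sum_sub_distrib]
      exact Finset.sum_congr rfl fun i _ => by ring
    rw [this]
    refine tendsto_finsetSum _ fun i _ => ?_
    rcases eq_or_ne (l i) 0 with h' | h'
    · simp [h']
    refine Tendsto.const_mul _ (Tendsto.sub_const ?_ _)
    have hlp := (hl i).lt_of_ne' h'
    have h1 : Tendsto (fun T : ℝ => k i * T⁻¹ + l i) atTop (𝓝 (l i)) := by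
      simpa using (tendsto_inv_atTop_zero.const_mul (k i)).add_const (l i)
    refine ((Real.continuousAt_log h').tendsto.comp h1).congr' ?_
    have h2 : Tendsto (fun T : ℝ => k i + T * l i) atTop atTop :=
      tendsto_atTop_add_const_left _ _ (tendsto_id.atTop_mul_const hlp)
    filter_upwards [h2.eventually_gt_atTop 0, eventually_gt_atTop 0] with T hT hT0
    rw [← Real.log_div hT.ne' hT0.ne', Function.comp_apply]
    congr 1
    field_simp
  refine le_of_tendsto_of_tendsto (hlim w' l' k' hl') (hlim w l k hl) ?_
  have hd : ∀ T : ℝ, 0 ≤ T → HasDerivAt (fun T => F w l k T - F w' l' k' T)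
      (∑ i, w i * (l i ^ 2 / (k i + T * l i)) - ∑ i, w' i * (l' i ^ 2 / (k' i + T * l' i))) T :=
    fun T hT => (hF w l k hl hk hs T hT).sub (hF w' l' k' hl' hk' hs' T hT)
  have hmono : MonotoneOn (fun T => F w l k T - F w' l' k' T) (Set.Ici 0) := by
    refine monotoneOn_of_deriv_nonneg (convex_Ici 0)
      (fun T hT => (hd T hT).continuousAt.continuousWithinAt) ?_ ?_
    · intro T hT
      rw [interior_Ici] at hT
      exact (hd T (le_of_lt hT)).differentiableAt.differentiableWithinAt
    · intro T hT
      rw [interior_Ici] at hT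
      rw [(hd T (le_of_lt hT)).deriv]
      exact sub_nonneg.2 (hQ T hT)
  filter_upwards [eventually_ge_atTop 0] with T hT
  have := hmono (Set.mem_Ici.2 le_rfl) hT hT
  simp only [F, zero_mul, add_zero, sub_self, mul_zero, Finset.sum_const_zero] at this
  rw [htr]
  simpa [F] using this

/-- The quadratic functional whose maximum over `X` is `⟪ρ, (L_σ + t R_ρ)⁻¹ ρ⟫`. -/
def resolventForm {n : Type} [Fintype n] (t : ℝ) (ρ σ X : Matrix n n ℂ) : ℝ :=
  2 * (Xᴴ * ρ).trace.re - (Xᴴ * σ * X).trace.re - t * (Xᴴ * X * ρ).trace.re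

theorem resolventForm_submatrix {n m : Type} [Fintype n] [Fintype m] (t : ℝ)
    (ρ σ X : Matrix n n ℂ) (e : m ≃ n) :
    resolventForm t (ρ.submatrix e e) (σ.submatrix e e) (X.submatrix e e) =
      resolventForm t ρ σ X := by
  have htr : ∀ M : Matrix n n ℂ, (M.submatrix e e).trace = M.trace := fun M =>
    Equiv.sum_comp e fun i => M i i
  simp only [resolventForm, Matrix.conjTranspose_submatrix, Matrix.submatrix_mul_equiv, htr]

theorem resolventForm_conj {n : Type} [Fintype n] [DecidableEq n] (t : ℝ) {P W : Matrix n n ℂ}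
    (l k : n → ℝ) (hP : Pᴴ * P = 1) (hW : Wᴴ * W = 1) (Y : Matrix n n ℂ) :
    resolventForm t (P * Matrix.diagonal (fun i => (l i : ℂ)) * Pᴴ)
      (W * Matrix.diagonal (fun i => (k i : ℂ)) * Wᴴ) (W * Y * Pᴴ) =
    ∑ j, ∑ i, (2 * (star (Y j i) * (Wᴴ * P) j i).re * l i
      - Complex.normSq (Y j i) * (k j + t * l i)) := by
  have h1 : ((W * Y * Pᴴ)ᴴ * (P * Matrix.diagonal (fun i => (l i : ℂ)) * Pᴴ)).trace =
      (Yᴴ * (Wᴴ * P) * Matrix.diagonal (fun i => (l i : ℂ))).trace := by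
    rw [show (W * Y * Pᴴ)ᴴ * (P * Matrix.diagonal (fun i => (l i : ℂ)) * Pᴴ) =
      (P * (Yᴴ * (Wᴴ * P) * Matrix.diagonal (fun i => (l i : ℂ)))) * Pᴴ by
        simp [Matrix.conjTranspose_mul, mul_assoc], Matrix.trace_mul_comm, ← mul_assoc, hP, one_mul]
  have h2 : ((W * Y * Pᴴ)ᴴ * (W * Matrix.diagonal (fun i => (k i : ℂ)) * Wᴴ) *
      (W * Y * Pᴴ)).trace = (Yᴴ * (Matrix.diagonal (fun i => (k i : ℂ)) * Y)).trace := by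
    rw [show (W * Y * Pᴴ)ᴴ * (W * Matrix.diagonal (fun i => (k i : ℂ)) * Wᴴ) * (W * Y * Pᴴ) =
      (P * (Yᴴ * (Wᴴ * W) * Matrix.diagonal (fun i => (k i : ℂ)) * (Wᴴ * W) * Y)) * Pᴴ by
        simp [Matrix.conjTranspose_mul, mul_assoc], Matrix.trace_mul_comm, ← mul_assoc, hP, hW,
        one_mul, mul_one, mul_one, mul_assoc]
  have h3 : ((W * Y * Pᴴ)ᴴ * (W * Y * Pᴴ) *
      (P * Matrix.diagonal (fun i => (l i : ℂ)) * Pᴴ)).trace =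
      (Yᴴ * Y * Matrix.diagonal (fun i => (l i : ℂ))).trace := by
    rw [show (W * Y * Pᴴ)ᴴ * (W * Y * Pᴴ) * (P * Matrix.diagonal (fun i => (l i : ℂ)) * Pᴴ) =
      (P * (Yᴴ * (Wᴴ * W) * Y * (Pᴴ * P) * Matrix.diagonal (fun i => (l i : ℂ)))) * Pᴴ by
        simp [Matrix.conjTranspose_mul, mul_assoc], Matrix.trace_mul_comm, ← mul_assoc, hP, hW,
        one_mul, mul_one, mul_one]
  rw [resolventForm, h1, h2, h3]
  generalize Wᴴ * P = c
  have e1 : (Yᴴ * c * Matrix.diagonal (fun i => (l i : ℂ))).trace.re =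
      ∑ j, ∑ i, (star (Y j i) * c j i).re * l i := by
    rw [Finset.sum_comm]
    simp only [Matrix.trace, Matrix.diag_apply, Matrix.mul_diagonal, Matrix.mul_apply (M := Yᴴ),
      Complex.re_sum, Matrix.conjTranspose_apply, Finset.sum_mul, Complex.re_mul_ofReal]
  have e2 : (Yᴴ * (Matrix.diagonal (fun i => (k i : ℂ)) * Y)).trace.re =
      ∑ j, ∑ i, Complex.normSq (Y j i) * k j := by
    rw [Finset.sum_comm]
    simp only [Matrix.trace, Matrix.diag_apply, Matrix.mul_apply (M := Yᴴ), Matrix.diagonal_mul,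
      Complex.re_sum, Matrix.conjTranspose_apply]
    refine Finset.sum_congr rfl fun i _ => Finset.sum_congr rfl fun j _ => ?_
    simp [Complex.normSq_apply]
    ring
  have e3 : (Yᴴ * Y * Matrix.diagonal (fun i => (l i : ℂ))).trace.re =
      ∑ j, ∑ i, Complex.normSq (Y j i) * l i := by
    rw [Finset.sum_comm]
    simp only [Matrix.trace, Matrix.diag_apply, Matrix.mul_apply (M := Yᴴ), Matrix.mul_diagonal,
      Complex.re_sum, Matrix.conjTranspose_apply, Finset.sum_mul]
    refine Finset.sum_congr rfl fun i _ => Finset.sum_congr rfl fun j _ => ?_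
    simp [Complex.normSq_apply]
  rw [e1, e2, e3]
  simp only [Finset.mul_sum, ← Finset.sum_sub_distrib]
  exact Finset.sum_congr rfl fun j _ => Finset.sum_congr rfl fun i _ => by ring

/-- The maximum of the resolvent form in terms of spectral decompositions. -/
theorem isGreatest_resolventForm {n : Type} [Fintype n] [DecidableEq n] {t : ℝ} (ht : 0 < t)
    {P W : Matrix n n ℂ} {l k : n → ℝ} (hl : ∀ i, 0 ≤ l i) (hk : ∀ i, 0 ≤ k i)
    (hP : Pᴴ * P = 1) (hW : Wᴴ * W = 1) (hW' : W * Wᴴ = 1) :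
    IsGreatest (Set.range (resolventForm t (P * Matrix.diagonal (fun i => (l i : ℂ)) * Pᴴ)
      (W * Matrix.diagonal (fun i => (k i : ℂ)) * Wᴴ)))
      (∑ x : n × n, Complex.normSq ((Wᴴ * P) x.1 x.2) * (l x.2 ^ 2 / (k x.1 + t * l x.2))) := by
  constructor
  · refine ⟨W * (Matrix.of fun j i =>
      ((l i / (k j + t * l i) : ℝ) : ℂ) * (Wᴴ * P) j i) * Pᴴ, ?_⟩
    rw [resolventForm_conj t l k hP hW, Fintype.sum_prod_type]
    refine Finset.sum_congr rfl fun j _ => Finset.sum_congr rfl fun i _ => ?_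
    simp only [Matrix.of_apply]
    generalize (Wᴴ * P) j i = c
    rcases eq_or_ne (l i) 0 with h | h
    · simp [h]
    have hlp := (hl i).lt_of_ne' h
    have hp : 0 < k j + t * l i := by have := hk j; positivity
    simp only [star_mul', Complex.normSq_mul, Complex.normSq_ofReal,
      Complex.star_def, Complex.conj_ofReal]
    rw [mul_assoc (_ : ℂ), ← Complex.normSq_eq_conj_mul_self, ← Complex.ofReal_mul,
      Complex.ofReal_re]
    field_simp
    ring
  · rintro _ ⟨X, rfl⟩
    have hX : X = W * (Wᴴ * X * P) * Pᴴ := by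
      rw [show W * (Wᴴ * X * P) * Pᴴ = (W * Wᴴ) * X * (P * Pᴴ) by simp only [mul_assoc], hW',
        mul_eq_one_comm.1 hP, one_mul, mul_one]
    generalize Wᴴ * X * P = Y at hX
    rw [hX, resolventForm_conj t l k hP hW, Fintype.sum_prod_type]
    refine Finset.sum_le_sum fun j _ => Finset.sum_le_sum fun i _ => ?_
    dsimp only
    generalize (Wᴴ * P) j i = c
    generalize Y j i = y
    rcases eq_or_ne (l i) 0 with h | h
    · simpa [h] using mul_nonneg (Complex.normSq_nonneg y) (hk j)
    have hlp := (hl i).lt_of_ne' h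
    have hp : 0 < k j + t * l i := by have := hk j; positivity
    generalize k j + t * l i = d at hp
    rw [← mul_div_assoc, le_div_iff₀ hp]
    have h1 := sq_nonneg (d * y.re - l i * c.re)
    have h2 := sq_nonneg (d * y.im - l i * c.im)
    simp only [Complex.normSq_apply, Complex.mul_re, Complex.star_def, Complex.conj_re,
      Complex.conj_im]
    nlinarith

end RelativeEntropy

section PartialTrace

variable {α β γ : Type}

theorem trace_ptraceLeft [Fintype α] [Fintype β] (ρ : Matrix (α × β) (α × β) ℂ) :
    (ptraceLeft ρ).trace = ρ.trace := by
  simp only [Matrix.trace, Matrix.diag_apply, ptraceLeft, Matrix.of_apply, Fintype.sum_prod_type]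
  exact Finset.sum_comm

theorem trace_ptraceRight [Fintype α] [Fintype β] (ρ : Matrix (α × β) (α × β) ℂ) :
    (ptraceRight ρ).trace = ρ.trace := by
  simp only [Matrix.trace, Matrix.diag_apply, ptraceRight, Matrix.of_apply, Fintype.sum_prod_type]

theorem ptraceLeft_posSemidef [Fintype α] {ρ : Matrix (α × β) (α × β) ℂ} (h : ρ.PosSemidef) :
    (ptraceLeft ρ).PosSemidef := by
  have : ptraceLeft ρ = ∑ a : α, ρ.submatrix (fun b => (a, b)) (fun b => (a, b)) := by
    ext b b'
    simp [ptraceLeft, Matrix.sum_apply]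
  rw [this]
  exact Matrix.posSemidef_sum _ fun a _ => h.submatrix _

theorem ptraceRight_posSemidef [Fintype β] {ρ : Matrix (α × β) (α × β) ℂ} (h : ρ.PosSemidef) :
    (ptraceRight ρ).PosSemidef := by
  have : ptraceRight ρ = ∑ b : β, ρ.submatrix (fun a => (a, b)) (fun a => (a, b)) := by
    ext b b'
    simp [ptraceRight, Matrix.sum_apply]
  rw [this]
  exact Matrix.posSemidef_sum _ fun a _ => h.submatrix _

variable [Fintype α] [Fintype β] [Fintype γ]

theorem ptraceLeft_one_kronecker_mul [DecidableEq α] (Y : Matrix β β ℂ)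
    (M : Matrix (α × β) (α × β) ℂ) :
    ptraceLeft ((1 : Matrix α α ℂ) ⊗ₖ Y * M) = Y * ptraceLeft M := by
  ext b b'
  simp only [ptraceLeft, Matrix.of_apply, Matrix.mul_apply, Matrix.kroneckerMap_apply,
    Fintype.sum_prod_type, Matrix.one_apply, ite_mul, one_mul, zero_mul, Finset.mul_sum]
  rw [Finset.sum_comm (γ := β)]
  refine Finset.sum_congr rfl fun a _ => ?_
  rw [Finset.sum_comm]
  simp

theorem ptraceLeft_mul_one_kronecker [DecidableEq α] (Y : Matrix β β ℂ)
    (M : Matrix (α × β) (α × β) ℂ) :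
    ptraceLeft (M * (1 : Matrix α α ℂ) ⊗ₖ Y) = ptraceLeft M * Y := by
  ext b b'
  simp only [ptraceLeft, Matrix.of_apply, Matrix.mul_apply, Matrix.kroneckerMap_apply,
    Fintype.sum_prod_type, Matrix.one_apply, ite_mul, one_mul, zero_mul, mul_ite, mul_zero,
    Finset.sum_mul]
  rw [Finset.sum_comm (γ := β)]
  refine Finset.sum_congr rfl fun a _ => ?_
  rw [Finset.sum_comm]
  simp

theorem ptraceRight_kronecker_one_mul [DecidableEq β] (Y : Matrix α α ℂ)
    (M : Matrix (α × β) (α × β) ℂ) :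
    ptraceRight (Y ⊗ₖ (1 : Matrix β β ℂ) * M) = Y * ptraceRight M := by
  ext b b'
  simp only [ptraceRight, Matrix.of_apply, Matrix.mul_apply, Matrix.kroneckerMap_apply,
    Fintype.sum_prod_type, Matrix.one_apply, ite_mul, mul_one, zero_mul, mul_ite, mul_zero,
    Finset.mul_sum]
  rw [Finset.sum_comm]
  simp

theorem ptraceRight_mul_kronecker_one [DecidableEq β] (Y : Matrix α α ℂ)
    (M : Matrix (α × β) (α × β) ℂ) :
    ptraceRight (M * Y ⊗ₖ (1 : Matrix β β ℂ)) = ptraceRight M * Y := by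
  ext b b'
  simp only [ptraceRight, Matrix.of_apply, Matrix.mul_apply, Matrix.kroneckerMap_apply,
    Fintype.sum_prod_type, Matrix.one_apply, mul_one, mul_ite, mul_zero,
    Finset.sum_mul]
  rw [Finset.sum_comm]
  simp

theorem resolventForm_kronecker_one [DecidableEq β] (t : ℝ) (ρ σ : Matrix (α × β) (α × β) ℂ)
    (X : Matrix α α ℂ) :
    resolventForm t ρ σ (X ⊗ₖ (1 : Matrix β β ℂ)) =
      resolventForm t (ptraceRight ρ) (ptraceRight σ) X := by
  simp only [resolventForm, Matrix.conjTranspose_kronecker, Matrix.conjTranspose_one,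
    ← trace_ptraceRight (β := β), mul_assoc, ptraceRight_kronecker_one_mul,
    ptraceRight_mul_kronecker_one]

/-- Spectral data for the relative entropy of `ρ` with respect to `1 ⊗ ρ_β`. -/
theorem exists_spectral_relEntropy [DecidableEq α] [DecidableEq β]
    {ρ : Matrix (α × β) (α × β) ℂ} (hρ : ρ.PosSemidef) :
    ∃ w l k : (α × β) × (α × β) → ℝ, (∀ x, 0 ≤ l x) ∧ (∀ x, 0 ≤ k x) ∧
      (∀ x, w x ≠ 0 → l x ≠ 0 → k x ≠ 0) ∧ ∑ x, w x * l x = ρ.trace.re ∧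
      ∑ x, w x * l x * (Real.log (l x) - Real.log (k x)) = entropy (ptraceLeft ρ) - entropy ρ ∧
      ∀ t : ℝ, 0 < t → IsGreatest
        (Set.range (resolventForm t ρ ((1 : Matrix α α ℂ) ⊗ₖ ptraceLeft ρ)))
        (∑ x, w x * (l x ^ 2 / (k x + t * l x))) := by
  obtain ⟨P, l, hl, hP, hP', hρP⟩ := exists_unitary_diagonal hρ
  obtain ⟨W, k, hk, hW, hW', hρW⟩ := exists_unitary_diagonal (ptraceLeft_posSemidef hρ)
  set W₁ : Matrix (α × β) (α × β) ℂ := (1 : Matrix α α ℂ) ⊗ₖ W with hW₁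
  have hW₁H : W₁ᴴ = (1 : Matrix α α ℂ) ⊗ₖ Wᴴ := by
    rw [hW₁, Matrix.conjTranspose_kronecker, Matrix.conjTranspose_one]
  have hW₁u : W₁ᴴ * W₁ = 1 := by
    rw [hW₁H, hW₁, ← Matrix.mul_kronecker_mul, hW, one_mul, Matrix.one_kronecker_one]
  have hW₁uu : W₁ * W₁ᴴ = 1 := mul_eq_one_comm.1 hW₁u
  have hσ : (1 : Matrix α α ℂ) ⊗ₖ ptraceLeft ρ =
      W₁ * Matrix.diagonal (fun x : α × β => (k x.2 : ℂ)) * W₁ᴴ := by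
    rw [hρW, hW₁H, hW₁,
      show Matrix.diagonal (fun x : α × β => (k x.2 : ℂ)) =
        (1 : Matrix α α ℂ) ⊗ₖ Matrix.diagonal (fun i => (k i : ℂ)) by
          rw [← Matrix.diagonal_one, Matrix.diagonal_kronecker_diagonal]; simp,
      ← Matrix.mul_kronecker_mul, ← Matrix.mul_kronecker_mul, one_mul, one_mul]
  set c := W₁ᴴ * P with hc
  have hcd : W₁ᴴ * ρ * W₁ = c * Matrix.diagonal (fun i => (l i : ℂ)) * cᴴ := by
    rw [hc, hρP, Matrix.conjTranspose_mul, Matrix.conjTranspose_conjTranspose]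
    simp only [mul_assoc]
  have hcc : cᴴ * c = 1 := by
    rw [hc, Matrix.conjTranspose_mul, Matrix.conjTranspose_conjTranspose,
      show Pᴴ * W₁ * (W₁ᴴ * P) = Pᴴ * (W₁ * W₁ᴴ) * P by simp only [mul_assoc], hW₁uu, mul_one, hP]
  have hcol : ∀ i, ∑ x, Complex.normSq (c x i) = 1 := fun i => by
    have := congrFun (congrFun hcc i) i
    rw [Matrix.mul_apply, Matrix.one_apply_eq] at this
    simp only [Matrix.conjTranspose_apply, Complex.star_def, ← Complex.normSq_eq_conj_mul_self]
      at this
    exact_mod_cast this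
  have hrow : ∀ b, ∑ a, ∑ i, Complex.normSq (c (a, b) i) * l i = k b := fun b => by
    have h1 : ptraceLeft (W₁ᴴ * ρ * W₁) = Matrix.diagonal (fun i => (k i : ℂ)) := by
      rw [hW₁H, hW₁, ptraceLeft_mul_one_kronecker, ptraceLeft_one_kronecker_mul, hρW,
        show Wᴴ * (W * Matrix.diagonal (fun i => (k i : ℂ)) * Wᴴ) * W =
          (Wᴴ * W) * Matrix.diagonal (fun i => (k i : ℂ)) * (Wᴴ * W) by simp only [mul_assoc],
        hW, one_mul, mul_one]
    have h2 := congrFun (congrFun h1 b) b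
    rw [hcd, Matrix.diagonal_apply_eq] at h2
    simp only [ptraceLeft, Matrix.of_apply, Matrix.mul_apply (N := cᴴ), Matrix.mul_diagonal,
      Matrix.conjTranspose_apply, Complex.star_def] at h2
    have h3 : ∀ a i, c (a, b) i * (l i : ℂ) * (starRingEnd ℂ) (c (a, b) i) =
        ((Complex.normSq (c (a, b) i) * l i : ℝ) : ℂ) := fun a i => by
      rw [mul_right_comm, Complex.mul_conj]
      push_cast
      rfl
    simp only [h3] at h2
    exact_mod_cast h2
  refine ⟨fun x => Complex.normSq (c x.1 x.2), fun x => l x.2, fun x => k x.1.2,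
    fun x => hl _, fun x => hk _, ?_, ?_, ?_, ?_⟩
  · rintro ⟨⟨a, b⟩, i⟩ hw hli hkb
    have h1 := hrow b
    dsimp only at hw hli hkb
    have hn : ∀ a i, 0 ≤ Complex.normSq (c (a, b) i) * l i := fun a i =>
      mul_nonneg (Complex.normSq_nonneg _) (hl i)
    rw [hkb, Finset.sum_eq_zero_iff_of_nonneg fun a _ => Finset.sum_nonneg fun i _ => hn a i] at h1
    have h2 := h1 a (Finset.mem_univ _)
    rw [Finset.sum_eq_zero_iff_of_nonneg fun i _ => hn a i] at h2
    exact mul_ne_zero hw hli (h2 i (Finset.mem_univ _))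
  · rw [Fintype.sum_prod_type_right]
    simp only [← Finset.sum_mul, hcol, one_mul]
    rw [hρP, Matrix.trace_mul_comm, ← mul_assoc, hP, one_mul, Matrix.trace_diagonal]
    simp
  · simp only [mul_sub, Finset.sum_sub_distrib]
    have h1 : ∑ x : (α × β) × (α × β), Complex.normSq (c x.1 x.2) * l x.2 * Real.log (l x.2) =
        ∑ i, l i * Real.log (l i) := by
      rw [Fintype.sum_prod_type_right]
      simp only [mul_assoc, ← Finset.sum_mul, hcol, one_mul]
    have h2 : ∑ x : (α × β) × (α × β), Complex.normSq (c x.1 x.2) * l x.2 * Real.log (k x.1.2) =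
        ∑ b, k b * Real.log (k b) := by
      rw [Fintype.sum_prod_type, Fintype.sum_prod_type_right]
      simp only [← Finset.sum_mul, hrow]
    rw [h1, h2, hρW, entropy_unitary_diagonal _ hW, hρP, entropy_unitary_diagonal _ hP]
    ring
  · intro t ht
    rw [hσ, hρP]
    exact isGreatest_resolventForm ht hl (fun x => hk x.2) hP hW₁u hW₁uu

/-- **Strong subadditivity** of the von Neumann entropy. -/
theorem entropy_strong_subadditivity {ρ : Matrix ((α × β) × γ) ((α × β) × γ) ℂ}
    (hρ : ρ.PosSemidef) :
    entropy ρ + entropy (ptraceLeft (ptraceRight ρ)) ≤ entropy (ptraceRight ρ) +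
      entropy (ptraceLeft
        (ρ.submatrix (Equiv.prodAssoc α β γ).symm (Equiv.prodAssoc α β γ).symm)) := by
  set e := Equiv.prodAssoc α β γ
  have hσ : ptraceRight (((1 : Matrix α α ℂ) ⊗ₖ
      ptraceLeft (ρ.submatrix e.symm e.symm)).submatrix e e) =
      (1 : Matrix α α ℂ) ⊗ₖ ptraceLeft (ptraceRight ρ) := by
    ext ⟨a, b⟩ ⟨a', b'⟩
    simp only [ptraceRight, ptraceLeft, Matrix.of_apply, Matrix.submatrix_apply,
      Matrix.kroneckerMap_apply, e, Equiv.prodAssoc_apply, Equiv.prodAssoc_symm_apply]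
    change ∑ c, (1 : Matrix α α ℂ) a a' * ∑ x, ρ ((x, b), c) ((x, b'), c) =
      (1 : Matrix α α ℂ) a a' * ∑ x, ∑ c, ρ ((x, b), c) ((x, b'), c)
    rw [← Finset.mul_sum]
    congr 1
    exact Finset.sum_comm
  obtain ⟨w, l, k, hl, hk, hs, htr, hD, hQ⟩ :=
    exists_spectral_relEntropy (hρ.submatrix e.symm)
  obtain ⟨w', l', k', hl', hk', hs', htr', hD', hQ'⟩ :=
    exists_spectral_relEntropy (ptraceRight_posSemidef hρ)
  have hle : ∀ t : ℝ, 0 < t → ∑ x, w' x * (l' x ^ 2 / (k' x + t * l' x)) ≤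
      ∑ x, w x * (l x ^ 2 / (k x + t * l x)) := by
    intro t ht
    obtain ⟨X, hX⟩ := (hQ' t ht).1
    refine (hQ t ht).2 ⟨(X ⊗ₖ (1 : Matrix γ γ ℂ)).submatrix e.symm e.symm, ?_⟩
    rw [← hX, ← hσ, ← resolventForm_kronecker_one, ← resolventForm_submatrix t ρ _ _ e.symm]
    simp
  have htr'' : ∑ x, w' x * l' x = ∑ x, w x * l x := by
    rw [htr, htr', trace_ptraceRight]
    exact congrArg Complex.re (Equiv.sum_comp e.symm fun i => ρ i i).symm
  have := sum_mul_log_sub_log_le hl hk hs hl' hk' hs' htr'' hle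
  rw [hD, hD', entropy_submatrix] at this
  linarith

end PartialTrace

section Marginals

variable {m : ℕ} {U : Fin m → Type}

/-- The equivalence extending an assignment on `s` by a value at a new coordinate `i`. -/
def insertEquiv (U : Fin m → Type) {i : Fin m} {s : Finset (Fin m)} (hi : i ∉ s) :
    U i × (∀ j : {j : Fin m // j ∈ s}, U j.1) ≃ ∀ j : {j : Fin m // j ∈ insert i s}, U j.1 where
  toFun x j := if h : j.1 = i then h.symm.rec x.1 else
    x.2 ⟨j.1, Finset.mem_of_mem_insert_of_ne j.2 h⟩
  invFun f := (f ⟨i, Finset.mem_insert_self i s⟩, fun j => f ⟨j.1, Finset.mem_insert_of_mem j.2⟩)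
  left_inv := by
    rintro ⟨x, a⟩
    refine Prod.ext (by simp) (funext fun j => ?_)
    have : j.1 ≠ i := fun h => hi (h ▸ j.2)
    simp [this]
  right_inv f := by
    funext ⟨j, hj⟩
    by_cases h : j = i
    · subst h
      simp
    · simp [h]

theorem insertEquiv_self {i : Fin m} {s : Finset (Fin m)} (hi : i ∉ s) (x : U i)
    (a : ∀ j : {j : Fin m // j ∈ s}, U j.1) (h : i ∈ insert i s) :
    insertEquiv U hi (x, a) ⟨i, h⟩ = x := by
  simp [insertEquiv]

theorem insertEquiv_of_mem {i : Fin m} {s : Finset (Fin m)} (hi : i ∉ s) (x : U i)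
    (a : ∀ j : {j : Fin m // j ∈ s}, U j.1) {j : Fin m} (hj : j ∈ s) (h : j ∈ insert i s) :
    insertEquiv U hi (x, a) ⟨j, h⟩ = a ⟨j, hj⟩ := by
  have : j ≠ i := fun h => hi (h ▸ hj)
  simp [insertEquiv, this]

theorem glue_of_mem {s : Finset (Fin m)} (a : ∀ i : {j : Fin m // j ∈ s}, U i.1)
    (u : ∀ i : {j : Fin m // j ∉ s}, U i.1) {i : Fin m} (h : i ∈ s) : glue s a u i = a ⟨i, h⟩ :=
  dif_pos h

theorem glue_of_notMem {s : Finset (Fin m)} (a : ∀ i : {j : Fin m // j ∈ s}, U i.1)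
    (u : ∀ i : {j : Fin m // j ∉ s}, U i.1) {i : Fin m} (h : i ∉ s) : glue s a u i = u ⟨i, h⟩ :=
  dif_neg h

/-- Gluing as an equivalence. -/
def glueEquiv (U : Fin m → Type) (s : Finset (Fin m)) :
    (∀ i : {j : Fin m // j ∈ s}, U i.1) × (∀ i : {j : Fin m // j ∉ s}, U i.1) ≃ ∀ i, U i where
  toFun x := glue s x.1 x.2
  invFun f := (fun i => f i, fun i => f i)
  left_inv x := Prod.ext (funext fun i => glue_of_mem _ _ i.2)
    (funext fun i => glue_of_notMem _ _ i.2)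
  right_inv f := by
    funext i
    by_cases h : i ∈ s
    · exact glue_of_mem _ _ h
    · exact glue_of_notMem _ _ h

variable [∀ i, Fintype (U i)] {V : Type} [Fintype V]

/-- Marginals are compatible: summing out the coordinates of `t` outside `s`. -/
theorem sum_marginSub {Ψ : Matrix ((∀ i, U i) × V) ((∀ i, U i) × V) ℂ} {s t : Finset (Fin m)}
    (hst : s ⊆ t) {K : Type} [Fintype K]
    (E : K × (∀ i : {j : Fin m // j ∈ s}, U i.1) ≃ ∀ i : {j : Fin m // j ∈ t}, U i.1)
    (hE : ∀ x a j (hj : j ∈ s), E (x, a) ⟨j, hst hj⟩ = a ⟨j, hj⟩)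
    (hE' : ∀ x a a' j (hj : j ∈ t), j ∉ s → E (x, a) ⟨j, hj⟩ = E (x, a') ⟨j, hj⟩)
    (a a' : ∀ i : {j : Fin m // j ∈ s}, U i.1) (v v' : V) :
    ∑ x, marginSub Ψ t (E (x, a), v) (E (x, a'), v') = marginSub Ψ s (a, v) (a', v') := by
  let φ : K × (∀ i : {j : Fin m // j ∉ t}, U i.1) → ∀ i : {j : Fin m // j ∉ s}, U i.1 :=
    fun x i => glue t (E (x.1, a)) x.2 i.1
  have hφ : ∀ x u b, glue s b (φ (x, u)) = glue t (E (x, b)) u := fun x u b => by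
    funext j
    by_cases hs : j ∈ s
    · rw [glue_of_mem _ _ hs, glue_of_mem _ _ (hst hs), hE]
    rw [glue_of_notMem _ _ hs]
    by_cases ht : j ∈ t
    · simp only [φ]
      rw [glue_of_mem _ _ ht, glue_of_mem _ _ ht]
      exact hE' _ _ _ _ _ hs
    · simp only [φ]
      rw [glue_of_notMem _ _ ht, glue_of_notMem _ _ ht]
  have hbij : Function.Bijective φ := by
    constructor
    · rintro ⟨x, u⟩ ⟨y, w⟩ h
      have h1 : glue t (E (x, a)) u = glue t (E (y, a)) w := by rw [← hφ, ← hφ, h]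
      have h2 := (glueEquiv U t).injective (a₁ := (E (x, a), u)) (a₂ := (E (y, a), w)) h1
      have h3 := E.injective (congrArg Prod.fst h2)
      exact Prod.ext (Prod.mk.inj h3).1 (Prod.mk.inj h2).2
    · intro w
      obtain ⟨⟨b, u⟩, hbu⟩ := (glueEquiv U t).surjective (glue s a w)
      obtain ⟨⟨x, c⟩, rfl⟩ := E.surjective b
      have hbu' : glue t (E (x, c)) u = glue s a w := hbu
      rw [← hφ] at hbu'
      have := (glueEquiv U s).injective (a₁ := (c, φ (x, u))) (a₂ := (a, w)) hbu'
      exact ⟨(x, u), congrArg Prod.snd this⟩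
  simp only [marginSub, Matrix.of_apply]
  rw [← Fintype.sum_prod_type', ← hbij.sum_comp]
  exact Finset.sum_congr rfl fun x _ => by rw [← hφ, ← hφ]

theorem sum_marginSub_insertEquiv {Ψ : Matrix ((∀ i, U i) × V) ((∀ i, U i) × V) ℂ}
    {i : Fin m} {s : Finset (Fin m)} (hi : i ∉ s)
    (a a' : ∀ i : {j : Fin m // j ∈ s}, U i.1) (v v' : V) :
    ∑ x, marginSub Ψ (insert i s) (insertEquiv U hi (x, a), v) (insertEquiv U hi (x, a'), v') =
      marginSub Ψ s (a, v) (a', v') := by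
  refine sum_marginSub (Finset.subset_insert i s) (insertEquiv U hi) ?_ ?_ a a' v v'
  · intro x a j hj
    exact insertEquiv_of_mem hi x a hj _
  · intro x a a' j hj hjs
    obtain rfl := (Finset.mem_insert.1 hj).resolve_right hjs
    rw [insertEquiv_self, insertEquiv_self]

theorem marginSub_posSemidef {Ψ : Matrix ((∀ i, U i) × V) ((∀ i, U i) × V) ℂ}
    (h : Ψ.PosSemidef) (s : Finset (Fin m)) : (marginSub Ψ s).PosSemidef := by
  have : marginSub Ψ s = ∑ u : (∀ i : {j : Fin m // j ∉ s}, U i.1),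
      Ψ.submatrix (fun p => (glue s p.1 u, p.2)) (fun p => (glue s p.1 u, p.2)) := by
    ext p q
    simp [marginSub, Matrix.sum_apply]
  rw [this]
  exact Matrix.posSemidef_sum _ fun a _ => h.submatrix _

theorem ptraceLeft_marginSub (Ψ : Matrix ((∀ i, U i) × V) ((∀ i, U i) × V) ℂ)
    (s : Finset (Fin m)) : ptraceLeft (marginSub Ψ s) = ptraceLeft Ψ := by
  ext v v'
  simp only [ptraceLeft, marginSub, Matrix.of_apply]
  rw [← Fintype.sum_prod_type', ← (glueEquiv U s).sum_comp]
  rfl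

theorem trace_marginSub (Ψ : Matrix ((∀ i, U i) × V) ((∀ i, U i) × V) ℂ)
    (s : Finset (Fin m)) : (marginSub Ψ s).trace = Ψ.trace := by
  rw [← trace_ptraceLeft, ptraceLeft_marginSub, trace_ptraceLeft]

theorem entropy_marginSub_insert_insert_le {Ψ : Matrix ((∀ i, U i) × V) ((∀ i, U i) × V) ℂ}
    (hΨ : Ψ.PosSemidef) {i j : Fin m} {s : Finset (Fin m)} (hi : i ∉ s) (hj : j ∉ s)
    (hij : i ≠ j) :
    entropy (marginSub Ψ (insert i (insert j s))) + entropy (marginSub Ψ s) ≤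
      entropy (marginSub Ψ (insert i s)) + entropy (marginSub Ψ (insert j s)) := by
  have hi' : i ∉ insert j s := by simp [hi, hij]
  let e : (U i × ((∀ i : {j : Fin m // j ∈ s}, U i.1) × V)) × U j ≃
      (∀ k : {k : Fin m // k ∈ insert i (insert j s)}, U k.1) × V :=
    { toFun := fun x => (insertEquiv U hi' (x.1.1, insertEquiv U hj (x.2, x.1.2.1)), x.1.2.2)
      invFun := fun y =>
        ((((insertEquiv U hi').symm y.1).1,
          (((insertEquiv U hj).symm ((insertEquiv U hi').symm y.1).2).2, y.2)),
          ((insertEquiv U hj).symm ((insertEquiv U hi').symm y.1).2).1)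
      left_inv := fun x => by simp
      right_inv := fun y => by simp }
  let E : U j × (∀ k : {k : Fin m // k ∈ insert i s}, U k.1) ≃
      ∀ k : {k : Fin m // k ∈ insert i (insert j s)}, U k.1 :=
    { toFun := fun x => insertEquiv U hi' (((insertEquiv U hi).symm x.2).1,
        insertEquiv U hj (x.1, ((insertEquiv U hi).symm x.2).2))
      invFun := fun y => (((insertEquiv U hj).symm ((insertEquiv U hi').symm y).2).1,
        insertEquiv U hi (((insertEquiv U hi').symm y).1,
          ((insertEquiv U hj).symm ((insertEquiv U hi').symm y).2).2))
      left_inv := fun x => by simp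
      right_inv := fun y => by simp }
  have hE : ∀ y x a, E (y, insertEquiv U hi (x, a)) =
      insertEquiv U hi' (x, insertEquiv U hj (y, a)) := fun y x a => by simp [E]
  have hsub : insert i s ⊆ insert i (insert j s) :=
    Finset.insert_subset_insert _ (Finset.subset_insert _ _)
  have hright : ptraceRight ((marginSub Ψ (insert i (insert j s))).submatrix e e) =
      (marginSub Ψ (insert i s)).submatrix
        ((Equiv.prodAssoc _ _ _).symm.trans ((insertEquiv U hi).prodCongr (Equiv.refl V)))
        ((Equiv.prodAssoc _ _ _).symm.trans ((insertEquiv U hi).prodCongr (Equiv.refl V))) := by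
    ext ⟨x, a, v⟩ ⟨x', a', v'⟩
    have := sum_marginSub (Ψ := Ψ) hsub E ?_ ?_
      (insertEquiv U hi (x, a)) (insertEquiv U hi (x', a')) v v'
    · simp only [hE] at this
      exact this
    · intro y b k hk
      obtain ⟨⟨x, a⟩, rfl⟩ := (insertEquiv U hi).surjective b
      rw [hE]
      rcases Finset.mem_insert.1 hk with rfl | hks
      · rw [insertEquiv_self, insertEquiv_self]
      · rw [insertEquiv_of_mem hi' _ _ (Finset.mem_insert_of_mem hks),
          insertEquiv_of_mem hj _ _ hks, insertEquiv_of_mem hi _ _ hks]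
    · intro y b b' k hk hks
      obtain ⟨⟨x, a⟩, rfl⟩ := (insertEquiv U hi).surjective b
      obtain ⟨⟨x', a'⟩, rfl⟩ := (insertEquiv U hi).surjective b'
      obtain rfl : k = j := by
        simp only [Finset.mem_insert] at hk hks
        tauto
      rw [hE, hE, insertEquiv_of_mem hi' _ _ (Finset.mem_insert_self _ _),
        insertEquiv_of_mem hi' _ _ (Finset.mem_insert_self _ _), insertEquiv_self,
        insertEquiv_self]
  have hmid : ptraceLeft (ptraceRight ((marginSub Ψ (insert i (insert j s))).submatrix e e)) =
      marginSub Ψ s := by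
    rw [hright]
    ext ⟨a, v⟩ ⟨a', v'⟩
    exact sum_marginSub_insertEquiv hi a a' v v'
  let e' : ((∀ i : {j : Fin m // j ∈ s}, U i.1) × V) × U j ≃
      (∀ k : {k : Fin m // k ∈ insert j s}, U k.1) × V :=
    { toFun := fun x => (insertEquiv U hj (x.2, x.1.1), x.1.2)
      invFun := fun y => ((((insertEquiv U hj).symm y.1).2, y.2), ((insertEquiv U hj).symm y.1).1)
      left_inv := fun x => by simp
      right_inv := fun y => by simp }
  have hleft : ptraceLeft (((marginSub Ψ (insert i (insert j s))).submatrix e e).submatrix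
      (Equiv.prodAssoc _ _ _).symm (Equiv.prodAssoc _ _ _).symm) =
      (marginSub Ψ (insert j s)).submatrix e' e' := by
    ext ⟨⟨a, v⟩, y⟩ ⟨⟨a', v'⟩, y'⟩
    exact sum_marginSub_insertEquiv hi' (insertEquiv U hj (y, a)) (insertEquiv U hj (y', a')) v v'
  have := entropy_strong_subadditivity ((marginSub_posSemidef hΨ _).submatrix e)
  rwa [hmid, hleft, hright, entropy_submatrix, entropy_submatrix, entropy_submatrix] at this

theorem entropy_marginSub_insert_le {Ψ : Matrix ((∀ i, U i) × V) ((∀ i, U i) × V) ℂ}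
    (hΨ : Ψ.PosSemidef) {i : Fin m} {s : Finset (Fin m)} (hi : i ∉ s) :
    entropy (marginSub Ψ (insert i s)) + entropy (ptraceRight (marginSub Ψ s)) ≤
      entropy (ptraceRight (marginSub Ψ (insert i s))) + entropy (marginSub Ψ s) := by
  let e := (insertEquiv U hi).prodCongr (Equiv.refl V)
  have hright : ptraceRight ((marginSub Ψ (insert i s)).submatrix e e) =
      (ptraceRight (marginSub Ψ (insert i s))).submatrix (insertEquiv U hi) (insertEquiv U hi) :=
    rfl
  have hmid : ptraceLeft (ptraceRight ((marginSub Ψ (insert i s)).submatrix e e)) =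
      ptraceRight (marginSub Ψ s) := by
    ext a a'
    simp only [ptraceRight, Matrix.of_apply, ← sum_marginSub_insertEquiv hi]
    exact Finset.sum_comm
  have hleft : ptraceLeft (((marginSub Ψ (insert i s)).submatrix e e).submatrix
      (Equiv.prodAssoc _ _ _).symm (Equiv.prodAssoc _ _ _).symm) = marginSub Ψ s := by
    ext ⟨a, v⟩ ⟨a', v'⟩
    exact sum_marginSub_insertEquiv hi a a' v v'
  have := entropy_strong_subadditivity ((marginSub_posSemidef hΨ (insert i s)).submatrix e)
  rwa [hmid, hleft, hright, entropy_submatrix, entropy_submatrix] at this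

theorem ptraceRight_marginSub_of_prod {Ψ : Matrix ((∀ i, U i) × V) ((∀ i, U i) × V) ℂ}
    {σ : ∀ i, Matrix (U i) (U i) ℂ} (hσ : ∀ i, (σ i).trace = 1)
    (hprod : ptraceRight Ψ = Matrix.of fun u u' => ∏ i, σ i (u i) (u' i)) (s : Finset (Fin m)) :
    ptraceRight (marginSub Ψ s) =
      Matrix.of fun a a' => ∏ j : {j : Fin m // j ∈ s}, σ j.1 (a j) (a' j) := by
  ext a a'
  have h : ∀ u, ∑ v, Ψ (glue s a u, v) (glue s a' u, v) =
      ∏ i, σ i (glue s a u i) (glue s a' u i) := fun u =>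
    congrFun (congrFun hprod (glue s a u)) (glue s a' u)
  simp only [ptraceRight, marginSub, Matrix.of_apply]
  rw [Finset.sum_comm]
  simp only [h]
  have h' : ∀ u : (∀ i : {j : Fin m // j ∉ s}, U i.1),
      ∏ i, σ i (glue s a u i) (glue s a' u i) =
      (∏ j : {j : Fin m // j ∈ s}, σ j.1 (a j) (a' j)) *
        ∏ j : {j : Fin m // j ∉ s}, σ j.1 (u j) (u j) := fun u => by
    rw [← Fintype.prod_subtype_mul_prod_subtype (fun i => i ∈ s)]
    congr 1
    · exact Finset.prod_congr (by ext; simp) fun j _ => by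
        rw [glue_of_mem _ _ j.2, glue_of_mem _ _ j.2]
    · exact Finset.prod_congr rfl fun j _ => by
        rw [glue_of_notMem _ _ j.2, glue_of_notMem _ _ j.2]
  simp only [h', ← Finset.mul_sum]
  have h1 : ∑ u : (∀ i : {j : Fin m // j ∉ s}, U i.1),
      ∏ j : {j : Fin m // j ∉ s}, σ j.1 (u j) (u j) = 1 := by
    rw [← Fintype.prod_sum fun (j : {j : Fin m // j ∉ s}) x => σ j.1 x x]
    exact Finset.prod_eq_one fun j _ => hσ j.1
  rw [h1, mul_one]

theorem entropy_ptraceRight_marginSub_insert {Ψ : Matrix ((∀ i, U i) × V) ((∀ i, U i) × V) ℂ}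
    (hΨ : Ψ.PosSemidef) (hΨ1 : Ψ.trace = 1) {σ : ∀ i, Matrix (U i) (U i) ℂ}
    (hσ : ∀ i, (σ i).PosSemidef) (hσ1 : ∀ i, (σ i).trace = 1)
    (hprod : ptraceRight Ψ = Matrix.of fun u u' => ∏ i, σ i (u i) (u' i))
    {i : Fin m} {s : Finset (Fin m)} (hi : i ∉ s) :
    entropy (ptraceRight (marginSub Ψ (insert i s))) =
      entropy (σ i) + entropy (ptraceRight (marginSub Ψ s)) := by
  rw [← entropy_kronecker (hσ i) (ptraceRight_posSemidef (marginSub_posSemidef hΨ s)) (hσ1 i)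
    (by rw [trace_ptraceRight, trace_marginSub, hΨ1]), ← entropy_submatrix _ (insertEquiv U hi)]
  congr 1
  ext ⟨x, a⟩ ⟨x', a'⟩
  simp only [ptraceRight_marginSub_of_prod hσ1 hprod, Matrix.submatrix_apply, Matrix.of_apply,
    Matrix.kroneckerMap_apply]
  rw [← (Finset.subtypeInsertEquivOption hi).symm.prod_comp, Fintype.prod_option]
  congr 1
  · exact congrArg₂ (σ i) (insertEquiv_self hi x a _) (insertEquiv_self hi x' a' _)
  · exact Finset.prod_congr rfl fun j _ => congrArg₂ (σ j.1)
      (insertEquiv_of_mem hi x a j.2 _) (insertEquiv_of_mem hi x' a' j.2 _)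

theorem mutInfoM_submatrix {α β α' : Type} [Fintype α] [Fintype β] [Fintype α']
    (ρ : Matrix (α × β) (α × β) ℂ) (e : α' ≃ α) :
    mutInfoM (ρ.submatrix (e.prodCongr (Equiv.refl β)) (e.prodCongr (Equiv.refl β))) =
      mutInfoM ρ := by
  have h1 : ptraceRight (ρ.submatrix (e.prodCongr (Equiv.refl β)) (e.prodCongr (Equiv.refl β))) =
      (ptraceRight ρ).submatrix e e := rfl
  have h2 : ptraceLeft (ρ.submatrix (e.prodCongr (Equiv.refl β)) (e.prodCongr (Equiv.refl β))) =
      ptraceLeft ρ := by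
    ext b b'
    exact e.sum_comp fun a => ρ (a, b) (a, b')
  rw [mutInfoM, mutInfoM, h1, h2, entropy_submatrix, entropy_submatrix]

theorem mutInfoM_of_unique {α β : Type} [Fintype α] [Fintype β] [Unique α]
    {ρ : Matrix (α × β) (α × β) ℂ} (h : ρ.trace = 1) : mutInfoM ρ = 0 := by
  have h1 : ptraceLeft ρ =
      ρ.submatrix (Equiv.uniqueProd β α).symm (Equiv.uniqueProd β α).symm := by
    ext b b'
    simp [ptraceLeft]
  rw [mutInfoM, entropy_of_unique (by rw [trace_ptraceRight, h]), h1, entropy_submatrix]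
  ring

theorem mutInfoM_marginSub_univ (Ψ : Matrix ((∀ i, U i) × V) ((∀ i, U i) × V) ℂ) :
    mutInfoM (marginSub Ψ Finset.univ) = mutInfoM Ψ := by
  let e : (∀ i : {j : Fin m // j ∈ Finset.univ}, U i.1) ≃ ∀ i, U i :=
    { toFun := fun a i => a ⟨i, Finset.mem_univ i⟩
      invFun := fun f i => f i.1
      left_inv := fun a => rfl
      right_inv := fun f => rfl }
  rw [← mutInfoM_submatrix Ψ e]
  congr 1
  have : IsEmpty {j : Fin m // j ∉ Finset.univ} := ⟨fun j => j.2 (Finset.mem_univ _)⟩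
  have hg : ∀ a u, glue (U := U) Finset.univ a u = e a := fun a u =>
    funext fun i => glue_of_mem a u (Finset.mem_univ i)
  ext p q
  simp [marginSub, hg, Prod.map]

end Marginals

/-- Shearer's inequality for normalized monotone supermodular set functions. -/
theorem sum_mul_le_of_supermodular {ι : Type} [Fintype ι] [DecidableEq ι] {f : Finset ι → ℝ}
    (h0 : f ∅ = 0) (hmono : ∀ i s, i ∉ s → f s ≤ f (insert i s))
    (hsup : ∀ i j s, i ∉ s → j ∉ s → i ≠ j →
      f (insert i s) + f (insert j s) ≤ f (insert i (insert j s)) + f s)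
    {c : ℝ} {ν : Finset ι → ℝ} (hν : ∀ s, 0 ≤ ν s)
    (hc : ∀ i, ∑ s ∈ Finset.univ.filter (fun s : Finset ι => i ∈ s), ν s ≤ c) :
    ∑ s, ν s * f s ≤ c * f Finset.univ := by
  have hsup' : ∀ (i : ι) (s t : Finset ι), i ∉ t → s ⊆ t →
      f (insert i s) - f s ≤ f (insert i t) - f t := by
    intro i s t hit hst
    suffices H : ∀ r : Finset ι, i ∉ r → Disjoint s r →
        f (insert i s) - f s ≤ f (insert i (s ∪ r)) - f (s ∪ r) by
      simpa [Finset.union_sdiff_of_subset hst] using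
        H (t \ s) (fun h => hit (Finset.sdiff_subset h)) Finset.disjoint_sdiff
    intro r
    induction r using Finset.induction_on with
    | empty => simp
    | insert j r hj ih =>
      intro hir hd
      simp only [Finset.mem_insert, not_or] at hir
      rw [Finset.disjoint_insert_right] at hd
      have h1 := ih hir.2 hd.2
      have h2 := hsup i j (s ∪ r) (by simp [hir.2, show i ∉ s from fun h => hit (hst h)])
        (by simp [hd.1, hj]) hir.1
      rw [Finset.union_insert]
      linarith
  suffices H : ∀ t : Finset ι, ∑ s, ν s * f (s ∩ t) ≤ c * f t by
    simpa using H Finset.univ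
  intro t
  induction t using Finset.induction_on with
  | empty => simp [h0]
  | insert i t hi ih =>
    have hstep : ∀ s, ν s * f (s ∩ insert i t) ≤
        ν s * f (s ∩ t) + (if i ∈ s then ν s else 0) * (f (insert i t) - f t) := by
      intro s
      by_cases his : i ∈ s
      · rw [if_pos his, Finset.inter_insert_of_mem his, ← mul_add]
        have := hsup' i (s ∩ t) t hi Finset.inter_subset_right
        exact mul_le_mul_of_nonneg_left (by linarith) (hν s)
      · rw [if_neg his, Finset.inter_insert_of_notMem his]
        simp
    calc ∑ s, ν s * f (s ∩ insert i t)
        ≤ ∑ s, ν s * f (s ∩ t) +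
          (∑ s, if i ∈ s then ν s else 0) * (f (insert i t) - f t) := by
          rw [Finset.sum_mul, ← Finset.sum_add_distrib]
          exact Finset.sum_le_sum fun s _ => hstep s
      _ ≤ c * f t + c * (f (insert i t) - f t) := by
          rw [← Finset.sum_filter]
          exact add_le_add ih (mul_le_mul_of_nonneg_right (hc i) (sub_nonneg.2 (hmono i t hi)))
      _ = c * f (insert i t) := by ring

/-- **Quantum Shearer lemma.**  If the marginal of `Ψ` on `U = U₁ × ⋯ × U_m` is a
tensor product, and `ν` is a distribution on subsets `s ⊆ [m]` such that each index
belongs to the random subset with probability at most `1/k`, then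
`E_{s←ν} I(U_s ; V)_Ψ ≤ I(U ; V)_Ψ / k`. -/
theorem quantum_shearer {m : ℕ} (U : Fin m → Type) [∀ i, Fintype (U i)]
    (V : Type) [Fintype V]
    (Ψ : Matrix ((∀ i, U i) × V) ((∀ i, U i) × V) ℂ)
    (hΨpsd : Ψ.PosSemidef) (hΨtr : Ψ.trace = 1)
    (σ : ∀ i, Matrix (U i) (U i) ℂ)
    (hσpsd : ∀ i, (σ i).PosSemidef) (hσtr : ∀ i, (σ i).trace = 1)
    (hprod : ptraceRight Ψ = Matrix.of fun u u' => ∏ i, σ i (u i) (u' i))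
    (k : ℝ) (hk : 0 < k)
    (ν : Finset (Fin m) → ℝ) (hν0 : ∀ s, 0 ≤ ν s) (hν1 : ∑ s, ν s = 1)
    (hνk : ∀ i : Fin m, ∑ s ∈ Finset.univ.filter (fun s : Finset (Fin m) => i ∈ s), ν s ≤ 1 / k) :
    ∑ s : Finset (Fin m), ν s * mutInfoM (marginSub Ψ s) ≤ mutInfoM Ψ / k := by
  rw [div_eq_inv_mul, ← one_div, ← mutInfoM_marginSub_univ]
  have hins : ∀ {i : Fin m} {s : Finset (Fin m)}, i ∉ s →
      entropy (ptraceRight (marginSub Ψ (insert i s))) =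
        entropy (σ i) + entropy (ptraceRight (marginSub Ψ s)) :=
    fun hi => entropy_ptraceRight_marginSub_insert hΨpsd hΨtr hσpsd hσtr hprod hi
  refine sum_mul_le_of_supermodular (f := fun s => mutInfoM (marginSub Ψ s)) ?_ ?_ ?_ hν0 hνk
  · have : IsEmpty {j : Fin m // j ∈ (∅ : Finset (Fin m))} :=
      ⟨fun j => Finset.notMem_empty _ j.2⟩
    exact mutInfoM_of_unique (by rw [trace_marginSub, hΨtr])
  · intro i s hi
    have := entropy_marginSub_insert_le hΨpsd hi
    simp only [mutInfoM, ptraceLeft_marginSub]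
    linarith
  · intro i j s hi hj hij
    have := entropy_marginSub_insert_insert_le hΨpsd hi hj hij
    have hi' : i ∉ insert j s := by simp [hi, hij]
    simp only [mutInfoM, ptraceLeft_marginSub, hins hi', hins hi, hins hj]
    linarith

end QI
end
end
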